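/- 𝓛(ε) is a maximal order of Q(𝓛(ε)) := Q(Z) ⊗_Z 𝓛(ε), where Z is the center of 𝓛(ε): the canonical image of 𝓛(ε) in Q(𝓛(ε)) is a classical order of Q(𝓛(ε)), and every classical order of Q(𝓛(ε)) containing this image is equal to it. -/

import Mathlib

set_option synthInstance.maxHeartbeats 1000000

noncomputable section

variable (R : Type*) [CommRing R]

/-- Generators. -/
def gA : FreeAlgebra R (Fin 4) := FreeAlgebra.ι R 0
def gB : FreeAlgebra R (Fin 4) := FreeAlgebra.ι R 1
def gC : FreeAlgebra R (Fin 4) := FreeAlgebra.ι R 2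
def gD : FreeAlgebra R (Fin 4) := FreeAlgebra.ι R 3

/-- Defining relations of 𝓛₀,₁, with `s` standing for `q²` and `t` for `q⁻²`. -/
inductive LRel (s t : R) : FreeAlgebra R (Fin 4) → FreeAlgebra R (Fin 4) → Prop
  | rel1 : LRel s t (gA R * gD R) (gD R * gA R)
  | rel2 : LRel s t (gA R * gB R - gB R * gA R)
      (-(algebraMap R (FreeAlgebra R (Fin 4)) (1 - t) * (gB R * gD R)))
  | rel3 : LRel s t (gD R * gB R) (algebraMap R (FreeAlgebra R (Fin 4)) s * (gB R * gD R))
  | rel4 : LRel s t (gC R * gB R - gB R * gC R)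
      (algebraMap R (FreeAlgebra R (Fin 4)) (1 - t) * (gD R * gA R - gD R * gD R))
  | rel5 : LRel s t (gC R * gD R) (algebraMap R (FreeAlgebra R (Fin 4)) s * (gD R * gC R))
  | rel6 : LRel s t (gA R * gC R - gC R * gA R)
      (algebraMap R (FreeAlgebra R (Fin 4)) (1 - t) * (gD R * gC R))
  | rel7 : LRel s t (gA R * gD R - algebraMap R (FreeAlgebra R (Fin 4)) s * (gB R * gC R)) 1

/-- The quantum loop algebra with parameters `s = q²`, `t = q⁻²`. -/
def QLoop (s t : R) : Type _ := RingQuot (LRel R s t)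

instance (s t : R) : Ring (QLoop R s t) := RingQuot.instRing _
instance (s t : R) : Algebra R (QLoop R s t) := RingQuot.instAlgebra _

/-- The generators a, b, c, d of the quantum loop algebra. -/
def qa (s t : R) : QLoop R s t := RingQuot.mkAlgHom R (LRel R s t) (gA R)
def qb (s t : R) : QLoop R s t := RingQuot.mkAlgHom R (LRel R s t) (gB R)
def qc (s t : R) : QLoop R s t := RingQuot.mkAlgHom R (LRel R s t) (gC R)
def qd (s t : R) : QLoop R s t := RingQuot.mkAlgHom R (LRel R s t) (gD R)

/-- The specialization 𝓛(q₀) at q = q₀ ∈ ℂ. -/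
def Lspec (q₀ : ℂ) : Type := QLoop ℂ (q₀ ^ 2) ((q₀ ^ 2)⁻¹)

instance (q₀ : ℂ) : Ring (Lspec q₀) := inferInstanceAs (Ring (QLoop ℂ _ _))
instance (q₀ : ℂ) : Algebra ℂ (Lspec q₀) := inferInstanceAs (Algebra ℂ (QLoop ℂ _ _))


/-- The generators a, b, c, d of 𝓛(q₀). -/
def la (q₀ : ℂ) : Lspec q₀ := qa ℂ (q₀ ^ 2) ((q₀ ^ 2)⁻¹)
def lb (q₀ : ℂ) : Lspec q₀ := qb ℂ (q₀ ^ 2) ((q₀ ^ 2)⁻¹)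
def lc (q₀ : ℂ) : Lspec q₀ := qc ℂ (q₀ ^ 2) ((q₀ ^ 2)⁻¹)
def ld (q₀ : ℂ) : Lspec q₀ := qd ℂ (q₀ ^ 2) ((q₀ ^ 2)⁻¹)

/-- The central element ω := q₀·a + q₀⁻¹·d of 𝓛(q₀). -/
def omegaL (q₀ : ℂ) : Lspec q₀ :=
  algebraMap ℂ (Lspec q₀) q₀ * la q₀ + algebraMap ℂ (Lspec q₀) q₀⁻¹ * ld q₀

open scoped TensorProduct

/-- The center `Z` of 𝓛(ε). -/
abbrev ZL (ε : ℂ) := Subring.center (Lspec ε)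

/-- The fraction field `Q(Z)` of the center of 𝓛(ε). -/
abbrev QZL (ε : ℂ) := FractionRing (ZL ε)

/-- `Q(𝓛(ε)) := Q(Z) ⊗_Z 𝓛(ε)`. -/
abbrev QLL (ε : ℂ) := (QZL ε) ⊗[ZL ε] (Lspec ε)

/-- The canonical image of 𝓛(ε) in `Q(𝓛(ε))`, `x ↦ 1 ⊗ x`, as a subring. -/
abbrev LBar (ε : ℂ) : Subring (QLL ε) :=
  (Algebra.TensorProduct.includeRight : Lspec ε →ₐ[ZL ε] QLL ε).toRingHom.range

/-- A subring `B` of `Q(𝓛(ε))` is a classical order: it contains the image of the center `Z`,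
it is finitely generated as a `Z`-module, and its `Q(Z)`-linear span is all of `Q(𝓛(ε))`. -/
def IsClassicalOrder (ε : ℂ) (B : Subring (QLL ε)) : Prop :=
  (algebraMap (ZL ε) (QLL ε)).range ≤ B ∧
  (Submodule.span (ZL ε) (B : Set (QLL ε))).FG ∧
  Submodule.span (QZL ε) (B : Set (QLL ε)) = ⊤

open Polynomial in
/-- The twisted group algebra of `ℤ × ℤ` over `ℂ[X]`: the quantum torus with `U V = s V U`, whose
basis element at `(i, j)` is `U ^ i * V ^ j`. -/
def QTorus (_s : ℂˣ) : Type := (ℤ × ℤ) →₀ ℂ[X]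

namespace QTorus

open Polynomial

variable {s : ℂˣ}

instance : AddCommGroup (QTorus s) := inferInstanceAs (AddCommGroup ((ℤ × ℤ) →₀ ℂ[X]))
instance : Module ℂ[X] (QTorus s) := inferInstanceAs (Module ℂ[X] ((ℤ × ℤ) →₀ ℂ[X]))
instance : Module ℂ (QTorus s) := inferInstanceAs (Module ℂ ((ℤ × ℤ) →₀ ℂ[X]))
instance : IsScalarTower ℂ ℂ[X] (QTorus s) :=
  inferInstanceAs (IsScalarTower ℂ ℂ[X] ((ℤ × ℤ) →₀ ℂ[X]))

/-- The monomial `r U ^ i V ^ j`, where `g = (i, j)`. -/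
def mon (s : ℂˣ) (g : ℤ × ℤ) : ℂ[X] →ₗ[ℂ[X]] QTorus s := Finsupp.lsingle g

/-- The coefficient of `U ^ i V ^ j`, where `g = (i, j)`. -/
def coeff (g : ℤ × ℤ) : QTorus s →ₗ[ℂ[X]] ℂ[X] := Finsupp.lapply g

/-- The exponents occurring in an element. -/
def supp (f : QTorus s) : Finset (ℤ × ℤ) := Finsupp.support f

lemma mem_supp {f : QTorus s} {g : ℤ × ℤ} : g ∈ f.supp ↔ coeff g f ≠ 0 := Finsupp.mem_support_iff

lemma coeff_mon (g h : ℤ × ℤ) (r : ℂ[X]) : coeff h (mon s g r) = if g = h then r else 0 := by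
  classical
  exact Finsupp.single_apply

@[ext] lemma ext_coeff {f g : QTorus s} (h : ∀ a, coeff a f = coeff a g) : f = g := Finsupp.ext h

lemma sum_mon (f : QTorus s) : ∑ g ∈ f.supp, mon s g (coeff g f) = f := Finsupp.sum_single f

lemma coeff_smul_complex (g : ℤ × ℤ) (c : ℂ) (f : QTorus s) : coeff g (c • f) = c • coeff g f := rfl

/-- The commutation factor, as a constant polynomial. -/
def tw (s : ℂˣ) (g h : ℤ × ℤ) : ℂ[X] := C ((s ^ (-(g.2 * h.1)) : ℂˣ) : ℂ)

lemma tw_ne_zero (g h : ℤ × ℤ) : tw s g h ≠ 0 :=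
  C_ne_zero.2 (Units.ne_zero _)

lemma tw_add_left (g g' h : ℤ × ℤ) : tw s (g + g') h = tw s g h * tw s g' h := by
  rw [tw, tw, tw, ← C_mul, ← Units.val_mul, ← zpow_add]
  congr 3
  simp only [Prod.snd_add]; ring

lemma tw_add_right (g h h' : ℤ × ℤ) : tw s g (h + h') = tw s g h * tw s g h' := by
  rw [tw, tw, tw, ← C_mul, ← Units.val_mul, ← zpow_add]
  congr 3
  simp only [Prod.fst_add]; ring

@[simp] lemma tw_zero_left (h : ℤ × ℤ) : tw s 0 h = 1 := by simp [tw]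

@[simp] lemma tw_zero_right (h : ℤ × ℤ) : tw s h 0 = 1 := by simp [tw]

/-- Multiplication as a bilinear map. -/
def mulL (s : ℂˣ) : QTorus s →ₗ[ℂ[X]] QTorus s →ₗ[ℂ[X]] QTorus s :=
  Finsupp.lsum (S := ℂ[X]) (fun g : ℤ × ℤ => LinearMap.flip
    (Finsupp.lsum (S := ℂ[X]) (fun h : ℤ × ℤ =>
      LinearMap.mk₂ ℂ[X] (fun r' r : ℂ[X] => mon s (g + h) (tw s g h * (r * r')))
        (by intros; rw [← map_add]; ring_nf) (by intros; rw [← map_smul]; simp; ring_nf)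
        (by intros; rw [← map_add]; ring_nf) (by intros; rw [← map_smul]; simp; ring_nf))))

lemma mulL_mon (g h : ℤ × ℤ) (r r' : ℂ[X]) :
    mulL s (mon s g r) (mon s h r') = mon s (g + h) (tw s g h * (r * r')) := by
  simp only [mulL, mon]
  erw [Finsupp.lsum_single, LinearMap.flip_apply, Finsupp.lsum_single]
  rfl

instance : Mul (QTorus s) := ⟨fun f g => mulL s f g⟩
instance : One (QTorus s) := ⟨mon s 0 1⟩

lemma mul_def (f g : QTorus s) : f * g = mulL s f g := rfl

lemma one_def : (1 : QTorus s) = mon s 0 1 := rfl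

lemma mon_mul_mon (g h : ℤ × ℤ) (r r' : ℂ[X]) :
    mon s g r * mon s h r' = mon s (g + h) (tw s g h * (r * r')) := mulL_mon g h r r'

lemma induction_mon {p : QTorus s → Prop} (f : QTorus s)
    (hadd : ∀ f g, p f → p g → p (f + g)) (hmon : ∀ g r, p (mon s g r)) : p f :=
  Finsupp.induction_linear f (by have h := hmon 0 0; rwa [map_zero] at h) hadd hmon

instance : NonUnitalNonAssocRing (QTorus s) where
  left_distrib f g h := by simp [mul_def]
  right_distrib f g h := by simp [mul_def]
  zero_mul f := by simp [mul_def]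
  mul_zero f := by simp [mul_def]

instance : Ring (QTorus s) where
  mul_assoc f g h := by
    induction f using induction_mon with
    | hadd f f' h1 h2 => simp only [add_mul, h1, h2]
    | hmon a r =>
    induction g using induction_mon with
    | hadd f f' h1 h2 => simp only [add_mul, mul_add, h1, h2]
    | hmon b r' =>
    induction h using induction_mon with
    | hadd f f' h1 h2 => simp only [mul_add, h1, h2]
    | hmon c r'' =>
    simp only [mon_mul_mon, tw_add_left, tw_add_right, add_assoc]
    congr 1
    ring
  one_mul f := by
    induction f using induction_mon with
    | hadd f f' h1 h2 => simp only [mul_add, h1, h2]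
    | hmon a r => simp [one_def, mon_mul_mon]
  mul_one f := by
    induction f using induction_mon with
    | hadd f f' h1 h2 => simp only [add_mul, h1, h2]
    | hmon a r => simp [one_def, mon_mul_mon]
  sub_eq_add_neg := sub_eq_add_neg
  zsmul := zsmulRec
  neg_add_cancel := neg_add_cancel

instance : Algebra ℂ[X] (QTorus s) :=
  Algebra.ofModule (fun r f g => by simp [mul_def]) (fun r f g => by simp [mul_def])

instance : Algebra ℂ (QTorus s) :=
  Algebra.ofModule
    (fun r f g => by rw [← algebraMap_smul ℂ[X], smul_mul_assoc, algebraMap_smul])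
    (fun r f g => by rw [← algebraMap_smul ℂ[X], mul_smul_comm, algebraMap_smul])

instance : Nontrivial (QTorus s) :=
  ⟨1, 0, fun h => by simpa [one_def, coeff_mon] using congrArg (coeff (s := s) 0) h⟩

lemma algebraMap_eq (r : ℂ[X]) : algebraMap ℂ[X] (QTorus s) r = mon s 0 r := by
  rw [Algebra.algebraMap_eq_smul_one, one_def, ← map_smul, smul_eq_mul, mul_one]

lemma algebraMap_complex_eq (r : ℂ) : algebraMap ℂ (QTorus s) r = mon s 0 (C r) := by
  rw [← algebraMap_eq, ← Polynomial.algebraMap_eq, ← IsScalarTower.algebraMap_apply]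

lemma coeff_mul (f g : QTorus s) (c : ℤ × ℤ) : coeff c (f * g) =
    ∑ a ∈ f.supp, ∑ b ∈ g.supp, if a + b = c then tw s a b * (coeff a f * coeff b g) else 0 := by
  conv_lhs => rw [← sum_mon f, ← sum_mon g, Finset.sum_mul_sum]
  simp only [map_sum, mon_mul_mon, coeff_mon]

/-- `a` is the lexicographically smallest exponent of `f`. -/
def IsMinExp (f : QTorus s) (a : ℤ × ℤ) : Prop :=
  coeff a f ≠ 0 ∧ ∀ b, coeff b f ≠ 0 → toLex a ≤ toLex b

lemma exists_isMinExp {f : QTorus s} (hf : f ≠ 0) : ∃ a, IsMinExp f a := by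
  have : f.supp.Nonempty := by
    by_contra h
    refine hf (ext_coeff fun a => ?_)
    by_contra h'
    exact h ⟨a, mem_supp.2 h'⟩
  obtain ⟨a, ha, h⟩ := f.supp.exists_min_image toLex this
  exact ⟨a, mem_supp.1 ha, fun b hb => h b (mem_supp.2 hb)⟩

lemma IsMinExp.mul {f g : QTorus s} {a b : ℤ × ℤ} (hf : IsMinExp f a) (hg : IsMinExp g b) :
    IsMinExp (f * g) (a + b) := by
  constructor
  · rw [coeff_mul, Finset.sum_eq_single_of_mem a (mem_supp.2 hf.1),
      Finset.sum_eq_single_of_mem b (mem_supp.2 hg.1), if_pos rfl]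
    · exact mul_ne_zero (tw_ne_zero _ _) (mul_ne_zero hf.1 hg.1)
    · intro b' _ hb'
      exact if_neg fun h => hb' (add_left_cancel h)
    · intro a' ha' hne
      refine Finset.sum_eq_zero fun b' hb' => if_neg fun h => ?_
      have h1 := lt_of_le_of_ne (hf.2 a' (mem_supp.1 ha')) fun h => hne (toLex.injective h).symm
      have h2 := add_lt_add_of_lt_of_le h1 (hg.2 b' (mem_supp.1 hb'))
      rw [← toLex_add, ← toLex_add, h] at h2
      exact lt_irrefl _ h2
  · intro c hc
    rw [coeff_mul] at hc
    obtain ⟨a', ha', hc⟩ := Finset.exists_ne_zero_of_sum_ne_zero hc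
    obtain ⟨b', hb', hc⟩ := Finset.exists_ne_zero_of_sum_ne_zero hc
    have h : a' + b' = c := by
      by_contra h
      exact hc (if_neg h)
    rw [← h, toLex_add, toLex_add]
    exact add_le_add (hf.2 a' (mem_supp.1 ha')) (hg.2 b' (mem_supp.1 hb'))

instance : IsDomain (QTorus s) :=
  have : NoZeroDivisors (QTorus s) := ⟨fun {f g} h => by
    by_contra! hne
    obtain ⟨a, ha⟩ := exists_isMinExp hne.1
    obtain ⟨b, hb⟩ := exists_isMinExp hne.2
    exact (ha.mul hb).1 (by rw [h, map_zero])⟩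
  NoZeroDivisors.to_isDomain _

/-- If all `x ^ n * j` involve only nonnegative powers of `U`, then so does `x`. -/
lemma fst_nonneg_of_pow_mul {x j : QTorus s} (hj : j ≠ 0)
    (h : ∀ n : ℕ, ∀ g, coeff g (x ^ n * j) ≠ 0 → 0 ≤ g.1) (g : ℤ × ℤ) (hg : coeff g x ≠ 0) :
    0 ≤ g.1 := by
  have hx : x ≠ 0 := by rintro rfl; simp at hg
  obtain ⟨a, ha⟩ := exists_isMinExp hx
  obtain ⟨b, hb⟩ := exists_isMinExp hj
  have key : ∀ n : ℕ, IsMinExp (x ^ n * j) ((n : ℤ) • a + b) := by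
    intro n
    induction n with
    | zero => simpa using hb
    | succ n ih =>
      rw [pow_succ', mul_assoc, Nat.cast_succ, add_smul, one_smul, add_comm _ a, add_assoc]
      exact ha.mul ih
  have ha0 : 0 ≤ a.1 := by
    by_contra! hneg
    have h1 := h (b.1.natAbs + 1) _ (key _).1
    simp only [Prod.fst_add, Prod.smul_fst, smul_eq_mul, Nat.cast_add, Nat.cast_one,
      Int.natCast_natAbs] at h1
    have h2 := le_abs_self b.1
    nlinarith [abs_nonneg b.1]
  have h3 := ha.2 g hg
  rw [Prod.Lex.toLex_le_toLex] at h3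
  omega

end QTorus

section LaurentNormal

open Polynomial

/-- The commutative Laurent polynomial ring in two variables over `ℂ[X]`. -/
abbrev LaurentTwo : Type := AddMonoidAlgebra ℂ[X] (ℤ × ℤ)

instance {A : Type*} [CommRing A] [IsDomain A] [UniqueFactorizationMonoid A] :
    UniqueFactorizationMonoid (LaurentPolynomial A) :=
  UniqueFactorizationMonoid.of_isLocalization (Submonoid.powers (X : A[X])) _

instance : UniqueFactorizationMonoid LaurentTwo :=
  have : UniqueFactorizationMonoid (AddMonoidAlgebra (AddMonoidAlgebra ℂ[X] ℤ) ℤ) :=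
    inferInstanceAs (UniqueFactorizationMonoid (LaurentPolynomial (LaurentPolynomial ℂ[X])))
  (AddMonoidAlgebra.curryRingEquiv (R := ℂ[X]) (M := ℤ) (N := ℤ)).toMulEquiv.symm
    |>.uniqueFactorizationMonoid this

/-- Factorial rings are completely integrally closed. -/
lemma dvd_of_pow_dvd_pow_mul {A : Type*} [CommRing A] [IsDomain A] [UniqueFactorizationMonoid A]
    {y z g : A} (hg : g ≠ 0) (hz : z ≠ 0) (h : ∀ n : ℕ, z ^ n ∣ y ^ n * g) : z ∣ y := by
  classical
  by_cases hy : y = 0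
  · simp [hy]
  let := UniqueFactorizationMonoid.strongNormalizationMonoid (α := A)
  rw [UniqueFactorizationMonoid.dvd_iff_normalizedFactors_le_normalizedFactors hz hy,
    Multiset.le_iff_count]
  intro p
  by_contra! hlt
  set m := Multiset.count p (UniqueFactorizationMonoid.normalizedFactors g)
  have h1 := h (m + 1)
  rw [UniqueFactorizationMonoid.dvd_iff_normalizedFactors_le_normalizedFactors
    (pow_ne_zero _ hz) (mul_ne_zero (pow_ne_zero _ hy) hg),
    UniqueFactorizationMonoid.normalizedFactors_mul (pow_ne_zero _ hy) hg,
    UniqueFactorizationMonoid.normalizedFactors_pow,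
    UniqueFactorizationMonoid.normalizedFactors_pow] at h1
  have h2 := Multiset.le_iff_count.1 h1 p
  rw [Multiset.count_nsmul, Multiset.count_add, Multiset.count_nsmul] at h2
  nlinarith

end LaurentNormal

namespace QTorus

open Polynomial AddMonoidAlgebra

variable {s : ℂˣ} {l : ℕ}

lemma tw_lattice_left (hs : IsPrimitiveRoot s l) (g h : ℤ × ℤ) : tw s ((l : ℤ) • g) h = 1 := by
  have : -(((l : ℤ) • g).2 * h.1) = l * (-(g.2 * h.1)) := by simp; ring
  rw [tw, this, zpow_mul, zpow_natCast, hs.pow_eq_one]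
  simp

lemma tw_lattice_right (hs : IsPrimitiveRoot s l) (g h : ℤ × ℤ) : tw s g ((l : ℤ) • h) = 1 := by
  have : -(g.2 * ((l : ℤ) • h).1) = l * (-(g.2 * h.1)) := by simp; ring
  rw [tw, this, zpow_mul, zpow_natCast, hs.pow_eq_one]
  simp

/-- The embedding of the commutative Laurent polynomials onto the center of the torus. -/
def ofCenter (hs : IsPrimitiveRoot s l) : LaurentTwo →+* QTorus s :=
  liftNCRingHom (algebraMap ℂ[X] (QTorus s))
    { toFun := fun g => mon s ((l : ℤ) • g.toAdd) 1
      map_one' := by simp [one_def]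
      map_mul' := fun g h => by
        rw [toAdd_mul, smul_add, mon_mul_mon, tw_lattice_left hs, one_mul, one_mul] }
    (fun x y => Algebra.commutes x _)

lemma ofCenter_single (hs : IsPrimitiveRoot s l) (g : ℤ × ℤ) (r : ℂ[X]) :
    ofCenter hs (single g r) = mon s ((l : ℤ) • g) r := by
  simp [ofCenter, algebraMap_eq, mon_mul_mon, -zsmul_eq_mul]

lemma lattice_injective (hl : 0 < l) : Function.Injective fun g : ℤ × ℤ => (l : ℤ) • g :=
  smul_right_injective _ (by exact_mod_cast hl.ne')

/-- The projection of the torus onto its center. -/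
def toCenter (s : ℂˣ) (hl : 0 < l) : QTorus s →+ LaurentTwo :=
  (coeffAddEquiv (R := ℂ[X]) (M := ℤ × ℤ)).symm.toAddMonoidHom.comp
    (Finsupp.comapDomain.addMonoidHom (lattice_injective hl))

lemma coeff_toCenter (hl : 0 < l) (f : QTorus s) (g : ℤ × ℤ) :
    (toCenter s hl f).coeff g = coeff ((l : ℤ) • g) f := rfl

lemma toCenter_mon_lattice (hl : 0 < l) (g : ℤ × ℤ) (r : ℂ[X]) :
    toCenter s hl (mon s ((l : ℤ) • g) r) = single g r := by
  ext1
  ext1 h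
  rw [coeff_toCenter, coeff_mon]
  classical
  rw [AddMonoidAlgebra.coeff_single, Finsupp.single_apply]
  simp only [(lattice_injective hl).eq_iff]

lemma toCenter_mon_of_notMem (hl : 0 < l) (g : ℤ × ℤ) (r : ℂ[X])
    (h : ∀ h : ℤ × ℤ, (l : ℤ) • h ≠ g) : toCenter s hl (mon s g r) = 0 := by
  ext1
  ext1 k
  rw [coeff_toCenter, coeff_mon, if_neg (h k).symm]
  rfl

lemma toCenter_ofCenter_mul (hl : 0 < l) (hs : IsPrimitiveRoot s l) (p : LaurentTwo)
    (f : QTorus s) : toCenter s hl (ofCenter hs p * f) = p * toCenter s hl f := by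
  induction f using induction_mon with
  | hadd f f' h1 h2 => simp only [mul_add, map_add, h1, h2]
  | hmon a r =>
  induction p using AddMonoidAlgebra.induction_linear with
  | zero => simp
  | add f f' h1 h2 => simp only [add_mul, map_add, h1, h2]
  | single b r' =>
  rw [ofCenter_single, mon_mul_mon, tw_lattice_left hs, one_mul]
  by_cases h : ∃ c : ℤ × ℤ, (l : ℤ) • c = a
  · obtain ⟨c, rfl⟩ := h
    rw [← smul_add, toCenter_mon_lattice, toCenter_mon_lattice, single_mul_single]
  · push Not at h
    rw [toCenter_mon_of_notMem hl a _ h, mul_zero, toCenter_mon_of_notMem]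
    intro c hc
    exact h (c - b) (by rw [smul_sub, hc]; abel)

lemma ofCenter_commute (hs : IsPrimitiveRoot s l) (p : LaurentTwo) (f : QTorus s) :
    ofCenter hs p * f = f * ofCenter hs p := by
  induction f using induction_mon with
  | hadd f f' h1 h2 => simp only [mul_add, add_mul, h1, h2]
  | hmon a r =>
  induction p using AddMonoidAlgebra.induction_linear with
  | zero => simp
  | add f f' h1 h2 => simp only [mul_add, add_mul, map_add, h1, h2]
  | single b r' =>
  rw [ofCenter_single, mon_mul_mon, mon_mul_mon, tw_lattice_left hs, tw_lattice_right hs, add_comm,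
    mul_comm r]

lemma sum_zpow_range (hs : IsPrimitiveRoot s l) (k : ℤ) :
    ∑ a ∈ Finset.range l, ((s ^ (k * a) : ℂˣ) : ℂ) = if (l : ℤ) ∣ k then (l : ℂ) else 0 := by
  have hs' : IsPrimitiveRoot (s : ℂ) l := hs.map_of_injective (f := Units.coeHom ℂ) Units.val_injective
  have h1 : ∀ a : ℕ, ((s ^ (k * a) : ℂˣ) : ℂ) = ((s : ℂ) ^ k) ^ a := fun a => by
    rw [zpow_mul, zpow_natCast]; push_cast; rfl
  simp only [h1]
  split_ifs with h
  · rw [(hs'.zpow_eq_one_iff_dvd k).2 h]; simp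
  · have h2 : (s : ℂ) ^ k ≠ 1 := fun h3 => h ((hs'.zpow_eq_one_iff_dvd k).1 h3)
    have h3 := mul_neg_geom_sum ((s : ℂ) ^ k) l
    rw [← zpow_natCast, ← zpow_mul, mul_comm k, zpow_mul, zpow_natCast, hs'.pow_eq_one, one_zpow,
      sub_self] at h3
    exact (mul_eq_zero.1 h3).resolve_left (sub_ne_zero.2 h2.symm)

/-- Averaging over conjugation by monomials projects onto the center. -/
lemma sum_conj (hl : 0 < l) (hs : IsPrimitiveRoot s l) (w : QTorus s) :
    ∑ a ∈ Finset.range l, ∑ b ∈ Finset.range l,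
      mon s ((a : ℤ), (b : ℤ)) (C ((s ^ (-(a * b : ℤ)) : ℂˣ) : ℂ)) * w *
        mon s (((l - a : ℕ) : ℤ), ((l - b : ℕ) : ℤ)) 1 =
    ofCenter hs (single (1, 1) (C ((l : ℂ) ^ 2)) * toCenter s hl w) := by
  induction w using induction_mon with
  | hadd f f' h1 h2 => simp only [mul_add, add_mul, Finset.sum_add_distrib, map_add, h1, h2]
  | hmon g r =>
  have key : ∀ a ∈ Finset.range l, ∀ b ∈ Finset.range l,
      mon s ((a : ℤ), (b : ℤ)) (C ((s ^ (-(a * b : ℤ)) : ℂˣ) : ℂ)) * mon s g r *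
        mon s (((l - a : ℕ) : ℤ), ((l - b : ℕ) : ℤ)) 1 =
      mon s (g + (l : ℤ) • (1, 1)) (C ((s ^ (g.2 * a) : ℂˣ) * (s ^ (-g.1 * b) : ℂˣ) : ℂ) * r) := by
    intro a ha b hb
    have ha' := (Finset.mem_range.1 ha).le
    have hb' := (Finset.mem_range.1 hb).le
    rw [mon_mul_mon, mon_mul_mon]
    have h1 : ((a : ℤ), (b : ℤ)) + g + (((l - a : ℕ) : ℤ), ((l - b : ℕ) : ℤ)) =
        g + (l : ℤ) • (1, 1) := by
      ext
      · simp [Nat.cast_sub ha']; ring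
      · simp [Nat.cast_sub hb']; ring
    rw [h1]
    congr 1
    have h2 : tw s (((a : ℤ), (b : ℤ)) + g) (((l - a : ℕ) : ℤ), ((l - b : ℕ) : ℤ)) =
        C ((s ^ ((b + g.2) * a : ℤ) : ℂˣ) : ℂ) := by
      rw [tw]
      have : -((((a : ℤ), (b : ℤ)) + g).2 * (((l - a : ℕ) : ℤ), ((l - b : ℕ) : ℤ)).1) =
        (b + g.2) * a + l * -(b + g.2) := by simp [Nat.cast_sub ha']; ring
      rw [this, zpow_add, zpow_mul _ (l : ℤ), zpow_natCast, hs.pow_eq_one]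
      simp
    rw [h2, tw, mul_one, ← mul_assoc, ← mul_assoc, ← C_mul, ← C_mul]
    congr 2
    norm_cast
    rw [← zpow_add, ← zpow_add, ← zpow_add]
    congr 1
    push_cast
    ring
  rw [Finset.sum_congr rfl fun a ha => Finset.sum_congr rfl (key a ha)]
  simp only [← map_sum, ← Finset.sum_mul, ← Finset.mul_sum, sum_zpow_range hs]
  by_cases h : ∃ c : ℤ × ℤ, (l : ℤ) • c = g
  · obtain ⟨c, rfl⟩ := h
    rw [if_pos (by simp), if_pos (by simp), toCenter_mon_lattice, single_mul_single, ofCenter_single,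
      smul_add, add_comm, sq]
  · rw [toCenter_mon_of_notMem hl g _ (not_exists.1 h)]
    have h' : ¬ ((l : ℤ) ∣ g.2 ∧ (l : ℤ) ∣ -g.1) := by
      rintro ⟨⟨b, hb⟩, h1⟩
      obtain ⟨a, ha⟩ := (dvd_neg.1 h1)
      exact h ⟨(a, b), by ext <;> simp [ha, hb]⟩
    split_ifs <;> simp_all

/-- The decomposition of the torus over its center. -/
lemma sum_toCenter_mul (hl : 0 < l) (hs : IsPrimitiveRoot s l) (y : QTorus s) :
    ∑ a ∈ Finset.range l, ∑ b ∈ Finset.range l,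
      ofCenter hs (toCenter s hl (y * mon s (-((a : ℤ), (b : ℤ))) 1)) *
        mon s ((a : ℤ), (b : ℤ)) (tw s ((a : ℤ), (b : ℤ)) ((a : ℤ), (b : ℤ))) = y := by
  induction y using induction_mon with
  | hadd f f' h1 h2 => simp only [add_mul, Finset.sum_add_distrib, map_add, h1, h2]
  | hmon g r =>
  have hl' : (l : ℤ) ≠ 0 := by exact_mod_cast hl.ne'
  have e : ∀ k : ℤ, ((k % l).toNat : ℤ) = k % l := fun k => Int.toNat_of_nonneg (Int.emod_nonneg k hl')
  have m : ∀ k : ℤ, (k % l).toNat ∈ Finset.range l := fun k => by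
    have := Int.emod_lt_of_pos k (b := l) (by omega)
    rw [Finset.mem_range]; have := e k; omega
  have u : ∀ (k : ℤ) (a : ℕ), a ∈ Finset.range l → (l : ℤ) ∣ k - a → a = (k % l).toNat := by
    intro k a ha hd
    have h1 := Int.emod_emod_of_dvd k (dvd_refl (l : ℤ))
    have h2 : k % l = (a : ℤ) % l := (Int.emod_emod_of_dvd _ dvd_rfl).symm.trans
      (by rw [h1]; exact (Int.emod_emod_of_dvd k dvd_rfl).symm.trans
            (by rw [h1]; exact Int.ModEq.symm ((Int.modEq_iff_dvd).2 hd)))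
    rw [h2, Int.emod_eq_of_lt (by omega) (by have := Finset.mem_range.1 ha; omega)]
    simp
  rw [Finset.sum_eq_single_of_mem _ (m g.1), Finset.sum_eq_single_of_mem _ (m g.2), e, e]
  · have h : g + -(g.1 % l, g.2 % l) = (l : ℤ) • (g.1 / l, g.2 / l) := by
      ext
      · simp; linarith [Int.mul_ediv_add_emod g.1 l]
      · simp; linarith [Int.mul_ediv_add_emod g.2 l]
    rw [mon_mul_mon, h, toCenter_mon_lattice, ofCenter_single, mon_mul_mon, tw_lattice_left hs, ← h]
    rw [neg_add_cancel_right]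
    congr 1
    have h3 : tw s g (-(g.1 % l, g.2 % l)) = tw s (g.1 % l, g.2 % l) (-(g.1 % l, g.2 % l)) := by
      have : g = (l : ℤ) • (g.1 / l, g.2 / l) + (g.1 % l, g.2 % l) := by
        rw [← h]; abel
      conv_lhs => rw [this]
      rw [tw_add_left, tw_lattice_left hs]
      simp
    rw [h3, one_mul, mul_one, mul_right_comm, ← tw_add_right, neg_add_cancel]
    simp
  · intro b hb hne
    rw [mon_mul_mon, toCenter_mon_of_notMem, map_zero, zero_mul]
    intro c hc
    refine hne (u _ _ hb ⟨c.2, ?_⟩)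
    have := congrArg Prod.snd hc
    simp at this
    linarith
  · intro a ha hne
    refine Finset.sum_eq_zero fun b hb => ?_
    rw [mon_mul_mon, toCenter_mon_of_notMem, map_zero, zero_mul]
    intro c hc
    refine hne (u _ _ ha ⟨c.1, ?_⟩)
    have := congrArg Prod.fst hc
    simp at this
    linarith

end QTorus

namespace QTorus

open Polynomial AddMonoidAlgebra

variable {s : ℂˣ} {l : ℕ}

lemma ofCenter_toCenter_of_commute (hl : 0 < l) (hs : IsPrimitiveRoot s l) {z : QTorus s}
    (hz : ∀ n m : ℕ, Commute z (mon s ((n : ℤ), (m : ℤ)) 1)) : ofCenter hs (toCenter s hl z) = z := by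
  have h1 := sum_conj hl hs z
  have h2 := sum_conj hl hs (1 : QTorus s)
  have h3 : ∀ (a b : ℕ) (c : ℂ), Commute (mon s ((a : ℤ), (b : ℤ)) (C c)) z := fun a b c => by
    have h := ((hz a b).symm.smul_left (C c))
    rwa [← map_smul, smul_eq_mul, mul_one] at h
  have h4 : toCenter s hl (1 : QTorus s) = 1 := by
    rw [one_def, ← smul_zero (l : ℤ), toCenter_mon_lattice, AddMonoidAlgebra.one_def]
  simp only [mul_one] at h2
  simp only [(h3 _ _ _).eq, mul_assoc z, ← Finset.mul_sum] at h1
  rw [h2, h4, mul_one, map_mul, ← ofCenter_commute] at h1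
  refine (mul_left_cancel₀ ?_ h1).symm
  rw [ofCenter_single]
  intro h
  have h5 := congrArg (coeff ((l : ℤ) • (1, 1))) h
  rw [coeff_mon, if_pos rfl, map_zero, C_eq_zero] at h5
  exact pow_ne_zero 2 (Nat.cast_ne_zero.2 hl.ne') h5

/-- If `y J ⊆ z J` for a nonzero module `J` over a subalgebra containing the monomials with
nonnegative exponents and a central element `z`, then `z` divides `y` in the torus. -/
lemma exists_eq_mul_of_forall_mem (hl : 0 < l) (hs : IsPrimitiveRoot s l)
    (A : Subalgebra ℂ (QTorus s)) (hA : ∀ n m : ℕ, mon s ((n : ℤ), (m : ℤ)) 1 ∈ A)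
    (J : AddSubgroup (QTorus s)) (hJ : ∀ u ∈ A, ∀ j ∈ J, u * j ∈ J) {j₀ : QTorus s}
    (hj₀ : j₀ ∈ J) (hj₀' : j₀ ≠ 0) {y z : QTorus s} (hz0 : z ≠ 0)
    (hz : ∀ n m : ℕ, Commute z (mon s ((n : ℤ), (m : ℤ)) 1))
    (hy : ∀ j ∈ J, ∃ j' ∈ J, y * j = z * j') : ∃ x, y = z * x := by
  set z' := toCenter s hl z with hz'
  have hzz : ofCenter hs z' = z := ofCenter_toCenter_of_commute hl hs hz
  have hz'0 : z' ≠ 0 := by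
    intro h
    rw [h, map_zero] at hzz
    exact hz0 hzz.symm
  have hAC : ∀ (n m : ℕ) (c : ℂ), mon s ((n : ℤ), (m : ℤ)) (C c) ∈ A := fun n m c => by
    have h := A.smul_mem (hA n m) c
    rwa [← algebraMap_smul ℂ[X], ← map_smul, smul_eq_mul, mul_one, Polynomial.algebraMap_eq] at h
  obtain ⟨k, hk⟩ : ∃ k : ℤ × ℤ, toCenter s hl (j₀ * mon s k 1) ≠ 0 := by
    by_contra! h
    refine hj₀' ?_
    rw [← sum_toCenter_mul hl hs j₀]
    simp [h]
  have key : ∀ u ∈ A, z' ∣ toCenter s hl (y * u) := by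
    intro u hu
    set e := single ((1, 1) : ℤ × ℤ) (C ((l : ℂ) ^ 2)) * toCenter s hl (y * u) with he
    have hstep : ∀ j ∈ J, ∃ j' ∈ J, ofCenter hs e * j = z * j' := by
      intro j hj
      rw [he, ← sum_conj]
      let I : AddSubgroup (QTorus s) := J.map (AddMonoidHom.mulLeft z)
      suffices h : (∑ a ∈ Finset.range l, ∑ b ∈ Finset.range l,
          mon s ((a : ℤ), (b : ℤ)) (C ((s ^ (-(a * b : ℤ)) : ℂˣ) : ℂ)) * (y * u) *
          mon s (((l - a : ℕ) : ℤ), ((l - b : ℕ) : ℤ)) 1) * j ∈ I by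
        obtain ⟨j', hj', h⟩ := h
        exact ⟨j', hj', h.symm⟩
      simp only [Finset.sum_mul]
      refine sum_mem fun a _ => sum_mem fun b _ => ?_
      obtain ⟨j₁, hj₁, h₁⟩ := hy _ (hJ _ (A.mul_mem hu (hA (l - a) (l - b))) j hj)
      refine ⟨mon s ((a : ℤ), (b : ℤ)) (C ((s ^ (-(a * b : ℤ)) : ℂˣ) : ℂ)) * j₁,
        hJ _ (hAC _ _ _) _ hj₁, ?_⟩
      rw [AddMonoidHom.coe_mulLeft, ← mul_assoc, ← hzz, ofCenter_commute, hzz, mul_assoc, ← h₁]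
      simp only [mul_assoc]
    have hpow : ∀ n : ℕ, ∃ j ∈ J, ofCenter hs (e ^ n) * j₀ = ofCenter hs (z' ^ n) * j := by
      intro n
      induction n with
      | zero => exact ⟨j₀, hj₀, by simp⟩
      | succ n ih =>
        obtain ⟨j, hj, h⟩ := ih
        obtain ⟨j', hj', h'⟩ := hstep j hj
        refine ⟨j', hj', ?_⟩
        rw [pow_succ', map_mul, mul_assoc, h, ← mul_assoc, ← map_mul, mul_comm, map_mul, mul_assoc,
          h', pow_succ, map_mul, hzz, mul_assoc]
    have hdvd : z' ∣ e := by
      refine dvd_of_pow_dvd_pow_mul hk hz'0 fun n => ?_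
      obtain ⟨j, -, h⟩ := hpow n
      refine ⟨toCenter s hl (j * mon s k 1), ?_⟩
      rw [← toCenter_ofCenter_mul hl hs, ← toCenter_ofCenter_mul hl hs, ← mul_assoc, h, mul_assoc]
    have hunit : single (-(1, 1) : ℤ × ℤ) (C (((l : ℂ) ^ 2)⁻¹)) * e = toCenter s hl (y * u) := by
      rw [he, ← mul_assoc, single_mul_single, neg_add_cancel, ← C_mul,
        inv_mul_cancel₀ (pow_ne_zero 2 (Nat.cast_ne_zero.2 hl.ne')), C_1]
      exact one_mul _
    rw [← hunit]
    exact hdvd.mul_left _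
  have hmon : ∀ a ∈ Finset.range l, ∀ b ∈ Finset.range l,
      z' ∣ toCenter s hl (y * mon s (-((a : ℤ), (b : ℤ))) 1) := by
    intro a ha b hb
    have h1 : mon s (-((a : ℤ), (b : ℤ))) 1 =
        mon s (((l - a : ℕ) : ℤ), ((l - b : ℕ) : ℤ)) 1 * ofCenter hs (single (-(1, 1)) 1) := by
      rw [ofCenter_single, mon_mul_mon, tw_lattice_right hs]
      simp only [mul_one]
      congr 2
      ext
      · simp [Nat.cast_sub (Finset.mem_range.1 ha).le]; ring
      · simp [Nat.cast_sub (Finset.mem_range.1 hb).le]; ring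
    rw [h1, ← mul_assoc, ← ofCenter_commute, toCenter_ofCenter_mul]
    exact (key _ (hA _ _)).mul_left _
  rw [← sum_toCenter_mul hl hs y]
  let I : AddSubgroup (QTorus s) := (AddMonoidHom.mulLeft z).range
  suffices h : _ ∈ I by
    obtain ⟨x, hx⟩ := h
    exact ⟨x, hx.symm⟩
  refine sum_mem fun a ha => sum_mem fun b hb => ?_
  obtain ⟨w, hw⟩ := hmon a ha b hb
  rw [hw, map_mul, hzz, mul_assoc]
  exact ⟨_, rfl⟩

/-- The component of degree `n` in `V`. -/
def comp (s : ℂˣ) (n : ℤ) : QTorus s →+ QTorus s :=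
  Finsupp.filterAddHom (M := ℂ[X]) fun g : ℤ × ℤ => g.2 = n

lemma comp_mon (n : ℤ) (g : ℤ × ℤ) (r : ℂ[X]) :
    comp s n (mon s g r) = if g.2 = n then mon s g r else 0 := by
  split_ifs with h
  · exact Finsupp.filter_single_of_pos (fun g : ℤ × ℤ => g.2 = n) h
  · exact Finsupp.filter_single_of_neg (fun g : ℤ × ℤ => g.2 = n) h

lemma coeff_comp (n : ℤ) (g : ℤ × ℤ) (f : QTorus s) :
    coeff g (comp s n f) = if g.2 = n then coeff g f else 0 := by
  classical
  exact Finsupp.filter_apply (fun g : ℤ × ℤ => g.2 = n) f g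

lemma comp_mul_comp (n k : ℤ) (f g : QTorus s) :
    comp s (n + k) (f * comp s k g) = comp s n f * comp s k g := by
  induction f using induction_mon with
  | hadd f f' h1 h2 => simp only [add_mul, map_add, h1, h2]
  | hmon a r =>
  induction g using induction_mon with
  | hadd f f' h1 h2 => simp only [mul_add, map_add, h1, h2]
  | hmon b r' =>
  rw [comp_mon, comp_mon]
  split_ifs with h1 h2 h2
  · rw [mon_mul_mon, comp_mon, if_pos (by simp [h1, h2])]
  · rw [mon_mul_mon, comp_mon, if_neg (by simp [h1]; omega), zero_mul]
  · simp
  · simp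

lemma sum_comp (f : QTorus s) : ∑ n ∈ f.supp.image Prod.snd, comp s n f = f := by
  ext1 g
  rw [map_sum]
  simp only [coeff_comp, Finset.sum_ite_eq]
  split_ifs with h
  · rfl
  · by_contra hne
    exact h (Finset.mem_image_of_mem _ (mem_supp.2 (Ne.symm hne)))

end QTorus

namespace Lspec

open Polynomial

variable {ε : ℂ}

/-- The quotient map from the free algebra. -/
def mk (ε : ℂ) : FreeAlgebra ℂ (Fin 4) →ₐ[ℂ] Lspec ε :=
  RingQuot.mkAlgHom ℂ (LRel ℂ (ε ^ 2) (ε ^ 2)⁻¹)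

lemma mk_eq {x y : FreeAlgebra ℂ (Fin 4)} (h : LRel ℂ (ε ^ 2) (ε ^ 2)⁻¹ x y) :
    mk ε x = mk ε y := RingQuot.mkAlgHom_rel ℂ h

lemma mk_gA : mk ε (gA ℂ) = la ε := rfl
lemma mk_gB : mk ε (gB ℂ) = lb ε := rfl
lemma mk_gC : mk ε (gC ℂ) = lc ε := rfl
lemma mk_gD : mk ε (gD ℂ) = ld ε := rfl

lemma la_mul_ld : la ε * ld ε = ld ε * la ε := by
  have h := mk_eq (ε := ε) LRel.rel1
  simpa only [map_mul (mk ε), map_sub (mk ε), map_neg (mk ε), map_one (mk ε), AlgHom.commutes,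
    mk_gA, mk_gB, mk_gC, mk_gD] using h

lemma la_mul_lb : la ε * lb ε - lb ε * la ε = -((1 - (ε ^ 2)⁻¹) • (lb ε * ld ε)) := by
  have h := mk_eq (ε := ε) LRel.rel2
  rw [Algebra.smul_def]
  simpa only [map_mul (mk ε), map_sub (mk ε), map_neg (mk ε), map_one (mk ε), AlgHom.commutes,
    mk_gA, mk_gB, mk_gC, mk_gD] using h

lemma ld_mul_lb : ld ε * lb ε = ε ^ 2 • (lb ε * ld ε) := by
  have h := mk_eq (ε := ε) LRel.rel3
  rw [Algebra.smul_def]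
  simpa only [map_mul (mk ε), map_sub (mk ε), map_neg (mk ε), map_one (mk ε), AlgHom.commutes,
    mk_gA, mk_gB, mk_gC, mk_gD] using h

lemma lc_mul_lb : lc ε * lb ε - lb ε * lc ε =
    (1 - (ε ^ 2)⁻¹) • (ld ε * la ε - ld ε * ld ε) := by
  have h := mk_eq (ε := ε) LRel.rel4
  rw [Algebra.smul_def]
  simpa only [map_mul (mk ε), map_sub (mk ε), map_neg (mk ε), map_one (mk ε), AlgHom.commutes,
    mk_gA, mk_gB, mk_gC, mk_gD] using h

lemma lc_mul_ld : lc ε * ld ε = ε ^ 2 • (ld ε * lc ε) := by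
  have h := mk_eq (ε := ε) LRel.rel5
  rw [Algebra.smul_def]
  simpa only [map_mul (mk ε), map_sub (mk ε), map_neg (mk ε), map_one (mk ε), AlgHom.commutes,
    mk_gA, mk_gB, mk_gC, mk_gD] using h

lemma la_mul_lc : la ε * lc ε - lc ε * la ε = (1 - (ε ^ 2)⁻¹) • (ld ε * lc ε) := by
  have h := mk_eq (ε := ε) LRel.rel6
  rw [Algebra.smul_def]
  simpa only [map_mul (mk ε), map_sub (mk ε), map_neg (mk ε), map_one (mk ε), AlgHom.commutes,
    mk_gA, mk_gB, mk_gC, mk_gD] using h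

lemma la_mul_ld_sub : la ε * ld ε - ε ^ 2 • (lb ε * lc ε) = 1 := by
  have h := mk_eq (ε := ε) LRel.rel7
  rw [Algebra.smul_def]
  simpa only [map_mul (mk ε), map_sub (mk ε), map_neg (mk ε), map_one (mk ε), AlgHom.commutes,
    mk_gA, mk_gB, mk_gC, mk_gD] using h

/-- The universal property of `𝓛(ε)`. -/
def lift {A : Type*} [Ring A] [Algebra ℂ A] (a b c d : A) (h1 : a * d = d * a)
    (h2 : a * b - b * a = -((1 - (ε ^ 2)⁻¹) • (b * d))) (h3 : d * b = ε ^ 2 • (b * d))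
    (h4 : c * b - b * c = (1 - (ε ^ 2)⁻¹) • (d * a - d * d)) (h5 : c * d = ε ^ 2 • (d * c))
    (h6 : a * c - c * a = (1 - (ε ^ 2)⁻¹) • (d * c)) (h7 : a * d - ε ^ 2 • (b * c) = 1) :
    Lspec ε →ₐ[ℂ] A :=
  RingQuot.liftAlgHom ℂ ⟨FreeAlgebra.lift ℂ ![a, b, c, d], by
    intro x y h
    set F := FreeAlgebra.lift ℂ ![a, b, c, d]
    have ha : F (gA ℂ) = a := by simp [F, gA]
    have hb : F (gB ℂ) = b := by simp [F, gB]
    have hc : F (gC ℂ) = c := by simp [F, gC]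
    have hd : F (gD ℂ) = d := by simp [F, gD]
    rw [Algebra.smul_def] at h2 h3 h4 h5 h6 h7
    cases h <;>
      simp only [ha, hb, hc, hd, map_mul F, map_sub F, map_neg F, map_one F, AlgHom.commutes] <;>
      assumption⟩

section lift

variable {A : Type*} [Ring A] [Algebra ℂ A] {a b c d : A} (h1 : a * d = d * a)
    (h2 : a * b - b * a = -((1 - (ε ^ 2)⁻¹) • (b * d))) (h3 : d * b = ε ^ 2 • (b * d))
    (h4 : c * b - b * c = (1 - (ε ^ 2)⁻¹) • (d * a - d * d)) (h5 : c * d = ε ^ 2 • (d * c))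
    (h6 : a * c - c * a = (1 - (ε ^ 2)⁻¹) • (d * c)) (h7 : a * d - ε ^ 2 • (b * c) = 1)

lemma lift_la : lift a b c d h1 h2 h3 h4 h5 h6 h7 (la ε) = a := by
  erw [lift, la, qa, RingQuot.liftAlgHom_mkAlgHom_apply]
  simp [gA]

lemma lift_lb : lift a b c d h1 h2 h3 h4 h5 h6 h7 (lb ε) = b := by
  erw [lift, lb, qb, RingQuot.liftAlgHom_mkAlgHom_apply]
  simp [gB]

lemma lift_lc : lift a b c d h1 h2 h3 h4 h5 h6 h7 (lc ε) = c := by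
  erw [lift, lc, qc, RingQuot.liftAlgHom_mkAlgHom_apply]
  simp [gC]

lemma lift_ld : lift a b c d h1 h2 h3 h4 h5 h6 h7 (ld ε) = d := by
  erw [lift, ld, qd, RingQuot.liftAlgHom_mkAlgHom_apply]
  simp [gD]

end lift

lemma induction_gen {p : Lspec ε → Prop} (y : Lspec ε) (hs : ∀ r, p (algebraMap ℂ _ r))
    (ha : p (la ε)) (hb : p (lb ε)) (hc : p (lc ε)) (hd : p (ld ε))
    (hmul : ∀ x y, p x → p y → p (x * y)) (hadd : ∀ x y, p x → p y → p (x + y)) : p y := by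
  obtain ⟨f, rfl⟩ := RingQuot.mkAlgHom_surjective ℂ (LRel ℂ (ε ^ 2) (ε ^ 2)⁻¹) y
  induction f using FreeAlgebra.induction with
  | grade0 r => erw [AlgHom.commutes]; exact hs r
  | grade1 i => fin_cases i <;> assumption
  | mul x y hx hy => erw [map_mul]; exact hmul _ _ hx hy
  | add x y hx hy => erw [map_add]; exact hadd _ _ hx hy

lemma omegaL_eq : omegaL ε = ε • la ε + ε⁻¹ • ld ε := by
  simp [omegaL, Algebra.smul_def]

lemma la_eq (hε : ε ≠ 0) : la ε = ε⁻¹ • omegaL ε - (ε ^ 2)⁻¹ • ld ε := by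
  rw [omegaL_eq, smul_add, smul_smul, smul_smul, inv_mul_cancel₀ hε, one_smul, ← mul_inv, ← sq,
    add_sub_cancel_right]

lemma lb_mul_lc (hε : ε ≠ 0) : lb ε * lc ε =
    ε⁻¹ ^ 3 • (omegaL ε * ld ε) - ε⁻¹ ^ 4 • (ld ε * ld ε) - ε⁻¹ ^ 2 • (1 : Lspec ε) := by
  have h : lb ε * lc ε = ε⁻¹ ^ 2 • (la ε * ld ε) - ε⁻¹ ^ 2 • (1 : Lspec ε) := by
    rw [← la_mul_ld_sub (ε := ε)]
    match_scalars <;> field_simp <;> ring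
  rw [h, la_eq hε, sub_mul, smul_mul_assoc, smul_mul_assoc]
  match_scalars <;> field_simp

lemma lc_mul_lb' (hε : ε ≠ 0) : lc ε * lb ε =
    ε⁻¹ • (omegaL ε * ld ε) - ld ε * ld ε - ε⁻¹ ^ 2 • (1 : Lspec ε) := by
  have h := lc_mul_lb (ε := ε)
  rw [← la_mul_ld, la_eq hε, sub_eq_iff_eq_add, lb_mul_lc hε, sub_mul, smul_mul_assoc,
    smul_mul_assoc] at h
  rw [h]
  match_scalars <;> field_simp <;> ring

lemma ld_commute_omegaL : Commute (ld ε) (omegaL ε) := by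
  rw [omegaL_eq]
  exact ((show Commute (ld ε) (la ε) from la_mul_ld.symm).smul_right _).add_right
    ((Commute.refl _).smul_right _)

lemma lb_commute_omegaL (hε : ε ≠ 0) : Commute (lb ε) (omegaL ε) := by
  have h := la_mul_lb (ε := ε)
  rw [sub_eq_iff_eq_add] at h
  rw [omegaL_eq, commute_iff_eq, mul_add, add_mul, mul_smul_comm, mul_smul_comm, smul_mul_assoc,
    smul_mul_assoc, h, ld_mul_lb]
  match_scalars <;> field_simp <;> ring

lemma lc_commute_omegaL (hε : ε ≠ 0) : Commute (lc ε) (omegaL ε) := by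
  have h := la_mul_lc (ε := ε)
  rw [sub_eq_iff_eq_add] at h
  rw [omegaL_eq, commute_iff_eq, mul_add, add_mul, mul_smul_comm, mul_smul_comm, smul_mul_assoc,
    smul_mul_assoc, h, lc_mul_ld]
  match_scalars <;> field_simp <;> ring

lemma omegaL_mem_center (hε : ε ≠ 0) : omegaL ε ∈ Subring.center (Lspec ε) := by
  rw [Subring.mem_center_iff]
  intro y
  suffices h : y ∈ Subalgebra.centralizer ℂ {omegaL ε} from
    ((Subalgebra.mem_centralizer_iff ℂ).1 h _ rfl).symm
  have h : ∀ {x : Lspec ε}, Commute x (omegaL ε) → x ∈ Subalgebra.centralizer ℂ {omegaL ε} :=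
    fun hx => (Subalgebra.mem_centralizer_iff ℂ).2 (by rintro _ rfl; exact hx.eq.symm)
  refine induction_gen y (fun r => Subalgebra.algebraMap_mem _ r) ?_ (h (lb_commute_omegaL hε))
    (h (lc_commute_omegaL hε)) (h ld_commute_omegaL) (fun _ _ => mul_mem) (fun _ _ => add_mem)
  rw [la_eq hε]
  exact sub_mem (Subalgebra.smul_mem _ (h (Commute.refl _)) _)
    (Subalgebra.smul_mem _ (h ld_commute_omegaL) _)

/-- The antiautomorphism of `𝓛(ε)` exchanging `b` and `c` and fixing `a` and `d`. -/
def anti (ε : ℂ) : Lspec ε →ₐ[ℂ] (Lspec ε)ᵐᵒᵖ :=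
  lift (.op (la ε)) (.op (lc ε)) (.op (lb ε)) (.op (ld ε))
    (by rw [← MulOpposite.op_mul, ← MulOpposite.op_mul, la_mul_ld])
    (by simp only [← MulOpposite.op_mul, ← MulOpposite.op_sub, ← MulOpposite.op_smul,
          ← MulOpposite.op_neg, ← la_mul_lc, neg_sub])
    (by simp only [← MulOpposite.op_mul, ← MulOpposite.op_smul, lc_mul_ld])
    (by simp only [← MulOpposite.op_mul, ← MulOpposite.op_smul, ← MulOpposite.op_sub, lc_mul_lb,
          la_mul_ld])
    (by simp only [← MulOpposite.op_mul, ← MulOpposite.op_smul, ld_mul_lb])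
    (by rw [← MulOpposite.op_mul, ← MulOpposite.op_mul, ← MulOpposite.op_mul, ← MulOpposite.op_sub,
          ← MulOpposite.op_smul, ← neg_sub, la_mul_lb, neg_neg])
    (by simp only [← MulOpposite.op_mul, ← MulOpposite.op_smul, ← MulOpposite.op_sub, ← la_mul_ld,
          la_mul_ld_sub, MulOpposite.op_one])

/-- `anti` as a map of `𝓛(ε)` to itself. -/
def tau (y : Lspec ε) : Lspec ε := (anti ε y).unop

lemma tau_mul (x y : Lspec ε) : tau (x * y) = tau y * tau x := by simp [tau]

lemma tau_add (x y : Lspec ε) : tau (x + y) = tau x + tau y := by simp [tau]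

lemma tau_lb : tau (lb ε) = lc ε := by simp [tau, anti, lift_lb]

lemma tau_tau (y : Lspec ε) : tau (tau y) = y := by
  induction y using induction_gen with
  | hs r => simp [tau, MulOpposite.algebraMap_apply]
  | ha => simp [tau, anti, lift_la]
  | hb => simp [tau, anti, lift_lb, lift_lc]
  | hc => simp [tau, anti, lift_lb, lift_lc]
  | hd => simp [tau, anti, lift_ld]
  | hmul x y hx hy => rw [tau_mul, tau_mul, hx, hy]
  | hadd x y hx hy => rw [tau_add, tau_add, hx, hy]

lemma tau_pow (y : Lspec ε) (n : ℕ) : tau (y ^ n) = tau y ^ n := by simp [tau]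

lemma tau_mem_center {z : Lspec ε} (hz : z ∈ Subring.center (Lspec ε)) :
    tau z ∈ Subring.center (Lspec ε) := by
  rw [Subring.mem_center_iff] at hz ⊢
  intro y
  rw [← tau_tau y, ← tau_mul, ← tau_mul, hz]

end Lspec

namespace QTorus

open Polynomial

variable {s : ℂˣ}

lemma mon_one_mul_mon (g h : ℤ × ℤ) (r r' : ℂ[X]) :
    mon s g r * mon s h r' = ((s ^ (-(g.2 * h.1)) : ℂˣ) : ℂ) • mon s (g + h) (r * r') := by
  rw [mon_mul_mon, tw, ← smul_eq_C_mul, ← algebraMap_smul ℂ[X] (_ : ℂ) (mon s (g + h) _),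
    ← map_smul, smul_eq_mul, smul_eq_C_mul, Polynomial.algebraMap_eq]

lemma mon_pow (g : ℤ × ℤ) (hg : g.1 * g.2 = 0) (n : ℕ) :
    mon s g 1 ^ n = mon s (n • g) 1 := by
  induction n with
  | zero => simp [one_def]
  | succ n ih =>
    have h : (n : ℤ) * g.2 * g.1 = 0 := by linear_combination (n : ℤ) * hg
    rw [pow_succ, ih, mon_one_mul_mon, succ_nsmul]
    simp [h]

end QTorus

namespace Lspec

open Polynomial QTorus

variable {ε : ℂ} (hε : ε ≠ 0)

/-- `ε²` as a unit. -/
abbrev sqUnit : ℂˣ := Units.mk0 (ε ^ 2) (pow_ne_zero 2 hε)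

/-- The embedding of `𝓛(ε)` in the quantum torus. -/
def toTorus : Lspec ε →ₐ[ℂ] QTorus (sqUnit hε) :=
  lift (ε⁻¹ • mon _ 0 X - (ε ^ 2)⁻¹ • mon _ (1, 0) 1) (mon _ (0, 1) 1)
    (ε⁻¹ • mon _ (1, -1) X - mon _ (2, -1) 1 - (ε ^ 2)⁻¹ • mon _ (0, -1) 1) (mon _ (1, 0) 1)
    (by
      simp only [sub_mul, mul_sub, smul_mul_assoc, mul_smul_comm, mon_one_mul_mon]
      simp)
    (by
      simp only [sub_mul, mul_sub, smul_mul_assoc, mul_smul_comm, mon_one_mul_mon]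
      simp
      match_scalars <;> field_simp <;> ring)
    (by
      simp only [mon_one_mul_mon]
      simp [smul_smul, hε])
    (by
      simp only [sub_mul, mul_sub, smul_mul_assoc, mul_smul_comm, mon_one_mul_mon]
      simp [zpow_ofNat]
      match_scalars <;> field_simp <;> ring)
    (by
      simp only [sub_mul, mul_sub, smul_mul_assoc, mul_smul_comm, mon_one_mul_mon]
      simp [zpow_ofNat]
      match_scalars <;> field_simp)
    (by
      simp only [sub_mul, mul_sub, smul_mul_assoc, mul_smul_comm, mon_one_mul_mon]
      simp [zpow_ofNat]
      match_scalars <;> field_simp <;> ring)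
    (by
      simp only [sub_mul, mul_sub, smul_mul_assoc, mul_smul_comm, mon_one_mul_mon, one_def]
      simp [zpow_ofNat]
      match_scalars <;> field_simp <;> ring)

lemma toTorus_la : toTorus hε (la ε) = ε⁻¹ • mon _ 0 X - (ε ^ 2)⁻¹ • mon _ (1, 0) 1 := lift_la ..

lemma toTorus_lb : toTorus hε (lb ε) = mon _ (0, 1) 1 := lift_lb ..

lemma toTorus_lc : toTorus hε (lc ε) =
    ε⁻¹ • mon _ (1, -1) X - mon _ (2, -1) 1 - (ε ^ 2)⁻¹ • mon _ (0, -1) 1 := lift_lc ..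

lemma toTorus_ld : toTorus hε (ld ε) = mon _ (1, 0) 1 := lift_ld ..

lemma toTorus_omegaL : toTorus hε (omegaL ε) = mon _ 0 X := by
  rw [omegaL_eq, map_add, map_smul, map_smul, toTorus_la, toTorus_ld]
  match_scalars <;> field_simp
  ring

/-- The homomorphism from `ℂ[X][Y]` to `𝓛(ε)` sending `X` to `ω` and `Y` to `d`. -/
def ofPoly (ε : ℂ) : ℂ[X][X] →ₐ[ℂ] Lspec ε :=
  eval₂AlgHom (aeval (omegaL ε)) (ld ε) fun r => by
    induction r using Polynomial.induction_on' with
    | add p q hp hq => rw [map_add]; exact hp.add_left hq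
    | monomial n r =>
      rw [aeval_monomial]
      exact (Algebra.commute_algebraMap_left _ _).mul_left (ld_commute_omegaL.symm.pow_left n)

lemma ofPoly_monomial (n : ℕ) (r : ℂ[X]) :
    ofPoly ε (monomial n r) = aeval (omegaL ε) r * ld ε ^ n := by
  simp [ofPoly, eval₂_monomial]

lemma ofPoly_X : ofPoly ε X = ld ε := by simp [ofPoly]

lemma ofPoly_C (r : ℂ[X]) : ofPoly ε (C r) = aeval (omegaL ε) r := by simp [ofPoly]

lemma toTorus_ofPoly_monomial (n : ℕ) (r : ℂ[X]) :
    toTorus hε (ofPoly ε (monomial n r)) = mon _ ((n : ℤ), 0) r := by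
  have h : toTorus hε (aeval (omegaL ε) r) = mon _ 0 r := by
    rw [← aeval_algHom_apply, toTorus_omegaL]
    have : mon (sqUnit hε) 0 X = algebraMap ℂ[X] _ X := (algebraMap_eq X).symm
    rw [this, aeval_algebraMap_apply, aeval_X_left_apply, algebraMap_eq]
  rw [ofPoly_monomial, map_mul, map_pow, h, toTorus_ld, mon_pow _ (by simp), mon_mul_mon]
  simp

lemma coeff_toTorus_ofPoly (p : ℂ[X][X]) (n : ℕ) :
    QTorus.coeff ((n : ℤ), 0) (toTorus hε (ofPoly ε p)) = p.coeff n := by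
  induction p using Polynomial.induction_on' with
  | add p q hp hq => rw [map_add, map_add, map_add, hp, hq, Polynomial.coeff_add]
  | monomial k r =>
    rw [toTorus_ofPoly_monomial, coeff_mon, Polynomial.coeff_monomial]
    simp

lemma comp_toTorus_ofPoly (p : ℂ[X][X]) :
    comp _ 0 (toTorus hε (ofPoly ε p)) = toTorus hε (ofPoly ε p) := by
  induction p using Polynomial.induction_on' with
  | add p q hp hq => simp only [map_add, hp, hq]
  | monomial k r => rw [toTorus_ofPoly_monomial, comp_mon, if_pos rfl]

/-- The homogeneous element `b ^ n`, or `c ^ (-n)` if `n` is negative. -/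
def homGen (ε : ℂ) : ℤ → Lspec ε
  | Int.ofNat n => lb ε ^ n
  | Int.negSucc n => lc ε ^ (n + 1)

lemma comp_pow {s : ℂˣ} {k : ℤ} {x : QTorus s} (hx : comp s k x = x) (n : ℕ) :
    comp s (n * k) (x ^ n) = x ^ n := by
  induction n with
  | zero => simp [one_def, comp_mon]
  | succ n ih =>
    rw [pow_succ, Nat.cast_succ, add_mul, one_mul]
    conv_lhs => rw [← hx, comp_mul_comp, hx, ih]

lemma comp_toTorus_lb_pow (n : ℕ) :
    comp _ n (toTorus hε (lb ε ^ n)) = toTorus hε (lb ε ^ n) := by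
  have := comp_pow (k := 1) (x := toTorus hε (lb ε)) (by rw [toTorus_lb, comp_mon, if_pos rfl]) n
  rwa [mul_one, ← map_pow] at this

lemma comp_smul {s : ℂˣ} (n : ℤ) (c : ℂ) (f : QTorus s) : comp s n (c • f) = c • comp s n f := by
  ext1 g
  rw [coeff_comp, coeff_smul_complex, coeff_smul_complex, coeff_comp]
  split_ifs <;> simp

lemma comp_toTorus_lc_pow (n : ℕ) :
    comp _ (-n) (toTorus hε (lc ε ^ n)) = toTorus hε (lc ε ^ n) := by
  have := comp_pow (k := -1) (x := toTorus hε (lc ε))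
    (by simp [toTorus_lc, comp_mon, comp_smul]) n
  rwa [mul_neg_one, ← map_pow] at this

lemma comp_toTorus_homGen (n : ℤ) :
    comp _ n (toTorus hε (homGen ε n)) = toTorus hε (homGen ε n) := by
  cases n with
  | ofNat n => exact comp_toTorus_lb_pow hε n
  | negSucc n => exact comp_toTorus_lc_pow hε (n + 1)

lemma comp_comp {s : ℂˣ} (n m : ℤ) (f : QTorus s) :
    comp s n (comp s m f) = if n = m then comp s n f else 0 := by
  ext1 g
  split_ifs <;> simp only [coeff_comp, map_zero] <;> grind

/-- The decomposition of `𝓛(ε)` by the powers of `b` and `c`. -/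
def ofHomogeneous (ε : ℂ) : (ℤ →₀ ℂ[X][X]) →+ Lspec ε :=
  Finsupp.liftAddHom fun n => (AddMonoidHom.mulRight (homGen ε n)).comp
    (ofPoly ε : ℂ[X][X] →+ Lspec ε)

lemma ofHomogeneous_single (n : ℤ) (p : ℂ[X][X]) :
    ofHomogeneous ε (Finsupp.single n p) = ofPoly ε p * homGen ε n := by
  simp [ofHomogeneous]

lemma comp_toTorus_ofHomogeneous (n : ℤ) (f : ℤ →₀ ℂ[X][X]) :
    comp _ n (toTorus hε (ofHomogeneous ε f)) =
      toTorus hε (ofPoly ε (f n)) * toTorus hε (homGen ε n) := by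
  induction f using Finsupp.induction_linear with
  | zero => simp
  | add f g hf hg => simp only [map_add, hf, hg, Finsupp.add_apply, add_mul]
  | single m p =>
    rw [ofHomogeneous_single, map_mul, Finsupp.single_apply]
    have h : toTorus hε (ofPoly ε p) * toTorus hε (homGen ε m) =
        comp _ m (toTorus hε (ofPoly ε p) * toTorus hε (homGen ε m)) := by
      have h0 := comp_mul_comp 0 m (toTorus hε (ofPoly ε p)) (toTorus hε (homGen ε m))
      rw [zero_add, comp_toTorus_homGen, comp_toTorus_ofPoly] at h0
      exact h0.symm
    rw [h, comp_comp]
    split_ifs with h1 h2 h2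
    · rw [← h1] at h; rw [← h1, ← h]
    · exact absurd h1.symm h2
    · exact absurd h2.symm h1
    · simp

lemma toTorus_homGen_ne_zero (n : ℤ) : toTorus hε (homGen ε n) ≠ 0 := by
  cases n with
  | ofNat n =>
    rw [homGen, map_pow, toTorus_lb]
    refine pow_ne_zero _ fun h => ?_
    simpa [coeff_mon] using congrArg (QTorus.coeff (0, 1)) h
  | negSucc n =>
    rw [homGen, map_pow, toTorus_lc]
    refine pow_ne_zero _ fun h => ?_
    simpa [coeff_mon, coeff_smul_complex] using congrArg (QTorus.coeff (2, -1)) h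

lemma toTorus_ofHomogeneous_injective {f : ℤ →₀ ℂ[X][X]}
    (h : toTorus hε (ofHomogeneous ε f) = 0) : f = 0 := by
  ext1 n
  have h1 := comp_toTorus_ofHomogeneous hε n f
  rw [h, map_zero, eq_comm, mul_eq_zero, or_iff_left (toTorus_homGen_ne_zero hε n)] at h1
  ext1 k
  rw [← coeff_toTorus_ofPoly hε, h1, map_zero]
  simp

lemma exists_mul_ofPoly {g : Lspec ε} (hg : Commute g (omegaL ε)) {t : ℂ}
    (ht : g * ld ε = t • (ld ε * g)) (p : ℂ[X][X]) :
    ∃ p', g * ofPoly ε p = ofPoly ε p' * g := by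
  induction p using Polynomial.induction_on with
  | C r =>
    refine ⟨C r, ?_⟩
    rw [ofPoly_C]
    induction r using Polynomial.induction_on' with
    | add p q hp hq => rw [map_add, mul_add, hp, hq, add_mul]
    | monomial n r =>
      rw [aeval_monomial]
      exact (Algebra.commute_algebraMap_right _ _).mul_right (hg.pow_right n)
  | add p q hp hq =>
    obtain ⟨p', hp⟩ := hp
    obtain ⟨q', hq⟩ := hq
    exact ⟨p' + q', by rw [map_add, mul_add, hp, hq, map_add, add_mul]⟩
  | monomial n r h =>
    obtain ⟨p', h⟩ := h
    refine ⟨p' * (t • X), ?_⟩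
    rw [pow_succ, ← mul_assoc, map_mul, ← mul_assoc, h, map_mul, map_smul, ofPoly_X, mul_assoc, ht,
      mul_smul_comm, mul_smul_comm, smul_mul_assoc, mul_assoc]

lemma lb_mul_ld (hε : ε ≠ 0) : lb ε * ld ε = (ε ^ 2)⁻¹ • (ld ε * lb ε) := by
  rw [ld_mul_lb, smul_smul, inv_mul_cancel₀ (pow_ne_zero 2 hε), one_smul]

lemma exists_ofPoly_eq_lb_mul_lc (hε : ε ≠ 0) : ∃ p, ofPoly ε p = lb ε * lc ε := by
  refine ⟨ε⁻¹ ^ 3 • (C X * X) - ε⁻¹ ^ 4 • (X * X) - ε⁻¹ ^ 2 • 1, ?_⟩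
  simp only [map_sub, map_smul, map_mul, map_one, ofPoly_X, ofPoly_C, aeval_X, lb_mul_lc hε]

lemma exists_ofPoly_eq_lc_mul_lb (hε : ε ≠ 0) : ∃ p, ofPoly ε p = lc ε * lb ε := by
  refine ⟨ε⁻¹ • (C X * X) - (X * X) - ε⁻¹ ^ 2 • 1, ?_⟩
  simp only [map_sub, map_smul, map_mul, map_one, ofPoly_X, ofPoly_C, aeval_X, lc_mul_lb' hε]

lemma exists_mul_homGen {g : Lspec ε} (hg : Commute g (omegaL ε)) {t : ℂ}
    (ht : g * ld ε = t • (ld ε * g)) (h : ∀ n, ∃ p m, g * homGen ε n = ofPoly ε p * homGen ε m)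
    {x : Lspec ε} (hx : x ∈ AddMonoidHom.mrange (ofHomogeneous ε)) :
    g * x ∈ AddMonoidHom.mrange (ofHomogeneous ε) := by
  obtain ⟨f, rfl⟩ := hx
  induction f using Finsupp.induction_linear with
  | zero => simp
  | add f f' hf hf' => rw [map_add, mul_add]; exact add_mem hf hf'
  | single n p =>
    obtain ⟨p', hp⟩ := exists_mul_ofPoly hg ht p
    obtain ⟨q, m, hq⟩ := h n
    refine ⟨Finsupp.single m (p' * q), ?_⟩
    rw [ofHomogeneous_single, ofHomogeneous_single, ← mul_assoc, hp, mul_assoc, hq, map_mul,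
      mul_assoc]

lemma ofHomogeneous_surjective (hε : ε ≠ 0) : Function.Surjective (ofHomogeneous ε) := by
  have hP : ∀ p : ℂ[X][X], ∀ x ∈ AddMonoidHom.mrange (ofHomogeneous ε),
      ofPoly ε p * x ∈ AddMonoidHom.mrange (ofHomogeneous ε) := by
    rintro p _ ⟨f, rfl⟩
    induction f using Finsupp.induction_linear with
    | zero => simp
    | add f f' hf hf' => rw [map_add, mul_add]; exact add_mem hf hf'
    | single n q =>
      refine ⟨Finsupp.single n (p * q), ?_⟩
      rw [ofHomogeneous_single, ofHomogeneous_single, map_mul, mul_assoc]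
  obtain ⟨q, hq⟩ := exists_ofPoly_eq_lb_mul_lc hε
  obtain ⟨q', hq'⟩ := exists_ofPoly_eq_lc_mul_lb hε
  have key : ∀ y : Lspec ε, ∀ x ∈ AddMonoidHom.mrange (ofHomogeneous ε),
      y * x ∈ AddMonoidHom.mrange (ofHomogeneous ε) := by
    intro y
    induction y using induction_gen with
    | hs r =>
      intro x hx
      have := hP (algebraMap ℂ _ r) x hx
      rwa [AlgHom.commutes] at this
    | ha =>
      intro x hx
      have := hP (ε⁻¹ • C X - (ε ^ 2)⁻¹ • X) x hx
      rwa [map_sub, map_smul, map_smul, ofPoly_C, ofPoly_X, aeval_X, ← la_eq hε] at this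
    | hb =>
      refine fun x => exists_mul_homGen (lb_commute_omegaL hε) (lb_mul_ld hε) fun n => ?_
      rcases n with n | _ | n
      · exact ⟨1, (n + 1 : ℕ), by rw [map_one, one_mul]; exact (pow_succ' _ _).symm⟩
      · exact ⟨q, 0, by rw [hq]; simp [homGen]⟩
      · exact ⟨q, Int.negSucc n, by simp only [hq, homGen]; rw [pow_succ' _ (n + 1), mul_assoc]⟩
    | hc =>
      refine fun x => exists_mul_homGen (lc_commute_omegaL hε) lc_mul_ld fun n => ?_
      rcases n with (_ | n) | n
      · exact ⟨1, Int.negSucc 0, by simp [homGen]⟩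
      · refine ⟨q', n, ?_⟩
        rw [hq']
        exact (congrArg _ (pow_succ' _ _)).trans (mul_assoc _ _ _).symm
      · exact ⟨1, Int.negSucc (n + 1), by simp only [homGen, map_one, one_mul, ← pow_succ']⟩
    | hd =>
      intro x hx
      have := hP X x hx
      rwa [ofPoly_X] at this
    | hmul x y hx hy => intro m hm; rw [mul_assoc]; exact hx _ (hy _ hm)
    | hadd x y hx hy => intro m hm; rw [add_mul]; exact add_mem (hx _ hm) (hy _ hm)
  intro x
  rw [← mul_one x]
  refine key x 1 ⟨Finsupp.single 0 1, ?_⟩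
  rw [ofHomogeneous_single]
  simp [homGen]

lemma toTorus_injective : Function.Injective (toTorus hε) := by
  rw [injective_iff_map_eq_zero]
  intro x hx
  obtain ⟨f, rfl⟩ := ofHomogeneous_surjective hε x
  rw [toTorus_ofHomogeneous_injective hε hx, map_zero]

lemma exists_comp_toTorus (x : Lspec ε) (n : ℤ) :
    ∃ p, comp _ n (toTorus hε x) = toTorus hε (ofPoly ε p * homGen ε n) := by
  obtain ⟨f, rfl⟩ := ofHomogeneous_surjective hε x
  exact ⟨f n, by rw [comp_toTorus_ofHomogeneous, map_mul]⟩

end Lspec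

namespace Lspec

open Polynomial QTorus

variable {ε : ℂ} (hε : ε ≠ 0)

lemma fst_nonneg_toTorus (y : Lspec ε) :
    ∀ g, QTorus.coeff g (toTorus hε y) ≠ 0 → 0 ≤ g.1 := by
  have hadd : ∀ u v : QTorus (sqUnit hε), (∀ g, QTorus.coeff g u ≠ 0 → 0 ≤ g.1) →
      (∀ g, QTorus.coeff g v ≠ 0 → 0 ≤ g.1) → ∀ g, QTorus.coeff g (u + v) ≠ 0 → 0 ≤ g.1 := by
    intro u v hu hv g hg
    rw [map_add] at hg
    by_cases h : QTorus.coeff g u = 0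
    · exact hv g (by rwa [h, zero_add] at hg)
    · exact hu g h
  have hmon : ∀ (a : ℤ × ℤ) (r : ℂ[X]), 0 ≤ a.1 →
      ∀ g, QTorus.coeff g (mon (sqUnit hε) a r) ≠ 0 → 0 ≤ g.1 := by
    intro a r ha g hg
    rw [coeff_mon] at hg
    split_ifs at hg with h
    · rwa [← h]
    · exact absurd rfl hg
  have hsmul : ∀ (t : ℂ) (a : ℤ × ℤ) (r : ℂ[X]), 0 ≤ a.1 →
      ∀ g, QTorus.coeff g (t • mon (sqUnit hε) a r) ≠ 0 → 0 ≤ g.1 := by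
    intro t a r ha g hg
    exact hmon a r ha g fun h => hg (by rw [coeff_smul_complex, h, smul_zero])
  induction y using induction_gen with
  | hs r => rw [AlgHom.commutes, algebraMap_complex_eq]; exact hmon _ _ le_rfl
  | ha =>
    rw [toTorus_la, sub_eq_add_neg, ← neg_smul]
    exact hadd _ _ (hsmul _ _ _ (by simp)) (hsmul _ _ _ (by simp))
  | hb => rw [toTorus_lb]; exact hmon _ _ (by simp)
  | hc =>
    rw [toTorus_lc, sub_eq_add_neg, sub_eq_add_neg, ← neg_smul, ← map_neg]
    exact hadd _ _ (hadd _ _ (hsmul _ _ _ (by simp)) (hmon _ _ (by simp))) (hsmul _ _ _ (by simp))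
  | hd => rw [toTorus_ld]; exact hmon _ _ (by simp)
  | hmul x y hx hy =>
    intro g hg
    rw [map_mul, coeff_mul] at hg
    obtain ⟨a, ha, hg⟩ := Finset.exists_ne_zero_of_sum_ne_zero hg
    obtain ⟨b, hb, hg⟩ := Finset.exists_ne_zero_of_sum_ne_zero hg
    split_ifs at hg with h
    · rw [← h]
      exact add_nonneg (hx a (mem_supp.1 ha)) (hy b (mem_supp.1 hb))
    · exact absurd rfl hg
  | hadd x y hx hy => rw [map_add]; exact hadd _ _ hx hy

lemma toTorus_ofPoly_mul_lb_pow (i j : ℕ) (r : ℂ[X]) :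
    toTorus hε (ofPoly ε (monomial i r) * lb ε ^ j) = mon _ ((i : ℤ), (j : ℤ)) r := by
  rw [map_mul, toTorus_ofPoly_monomial, map_pow, toTorus_lb, mon_pow _ (by simp), mon_mul_mon]
  simp [tw]

lemma exists_toTorus_eq_lb_pow_mul {x : QTorus (sqUnit hε)}
    (hx : ∀ g, QTorus.coeff g x ≠ 0 → 0 ≤ g.1) :
    ∃ (m : ℕ) (w : Lspec ε), toTorus hε w = toTorus hε (lb ε ^ m) * x := by
  let m : ℕ := x.supp.sup fun g => (-g.2).toNat
  refine ⟨m, ?_⟩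
  suffices h : toTorus hε (lb ε ^ m) * x ∈ (toTorus hε).range from h
  conv => enter [2, 2]; rw [← sum_mon x]
  rw [Finset.mul_sum]
  refine sum_mem fun g hg => ?_
  have h1 : (-g.2).toNat ≤ m := Finset.le_sup (f := fun g : ℤ × ℤ => (-g.2).toNat) hg
  have h2 := hx g (mem_supp.1 hg)
  rw [map_pow, toTorus_lb, mon_pow _ (by simp), mon_mul_mon]
  refine ⟨_, (toTorus_ofPoly_mul_lb_pow hε g.1.toNat (m + g.2).toNat
    (tw (sqUnit hε) (m • (0, 1)) g * (1 * QTorus.coeff g x))).trans ?_⟩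
  have h3 : ((g.1.toNat : ℤ), ((m + g.2).toNat : ℤ)) = m • (0, 1) + g := by
    ext
    · simpa using h2
    · rw [Prod.snd_add, Prod.smul_snd, nsmul_eq_mul, mul_one]
      omega
  rw [h3]

variable {l : ℕ}

lemma exists_toTorus_eq_mul (hl : 0 < l) (hs : IsPrimitiveRoot (sqUnit hε) l)
    {J : AddSubgroup (Lspec ε)} (hJ : ∀ u, ∀ j ∈ J, u * j ∈ J) {j₀ : Lspec ε} (hj₀ : j₀ ∈ J)
    (hj₀' : j₀ ≠ 0) {y z : Lspec ε} (hz : z ∈ Subring.center (Lspec ε)) (hz0 : z ≠ 0)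
    (hy : ∀ j ∈ J, ∃ j' ∈ J, y * j = z * j') :
    ∃ x : QTorus (sqUnit hε), toTorus hε y = toTorus hε z * x ∧
      (∀ g, QTorus.coeff g x ≠ 0 → 0 ≤ g.1) ∧
      ∃ (m : ℕ) (w : Lspec ε), lb ε ^ m * y = z * w := by
  have hz1 : toTorus hε z ≠ 0 := (map_ne_zero_iff _ (toTorus_injective hε)).2 hz0
  have hmon : ∀ n m : ℕ, mon (sqUnit hε) ((n : ℤ), (m : ℤ)) 1 ∈ (toTorus hε).range :=
    fun n m => ⟨_, toTorus_ofPoly_mul_lb_pow hε n m 1⟩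
  have hcomm : ∀ u, Commute (toTorus hε z) (toTorus hε u) := fun u => by
    rw [commute_iff_eq, ← map_mul, ← map_mul, Subring.mem_center_iff.1 hz u]
  obtain ⟨x, hx⟩ := exists_eq_mul_of_forall_mem hl hs (toTorus hε).range hmon
    (y := toTorus hε y) (z := toTorus hε z) (j₀ := toTorus hε j₀)
    (J.map (toTorus hε : Lspec ε →+ QTorus (sqUnit hε)))
    (by rintro _ ⟨u, rfl⟩ _ ⟨j, hj, rfl⟩; exact ⟨u * j, hJ u j hj, map_mul (toTorus hε) _ _⟩)
    ⟨j₀, hj₀, rfl⟩ ((map_ne_zero_iff _ (toTorus_injective hε)).2 hj₀') hz1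
    (fun n m => by obtain ⟨u, hu⟩ := hmon n m; rw [← hu]; exact hcomm u)
    (by
      rintro _ ⟨j, hj, rfl⟩
      obtain ⟨j', hj', h⟩ := hy j hj
      refine ⟨toTorus hε j', ⟨j', hj', rfl⟩, ?_⟩
      change toTorus hε y * toTorus hε j = _
      rw [← map_mul, h, map_mul])
  have hxJ : ∀ n : ℕ, ∃ j ∈ J, x ^ n * toTorus hε j₀ = toTorus hε j := by
    intro n
    induction n with
    | zero => exact ⟨j₀, hj₀, by rw [pow_zero, one_mul]⟩
    | succ n ih =>
      obtain ⟨j, hj, h⟩ := ih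
      obtain ⟨j', hj', h'⟩ := hy j hj
      refine ⟨j', hj', ?_⟩
      rw [pow_succ', mul_assoc, h]
      apply mul_left_cancel₀ hz1
      rw [← mul_assoc, ← hx, ← map_mul, h', map_mul]
  have hnonneg := fst_nonneg_of_pow_mul ((map_ne_zero_iff _ (toTorus_injective hε)).2 hj₀')
    fun n => by
      obtain ⟨j, -, h⟩ := hxJ n
      rw [h]
      exact fst_nonneg_toTorus hε j
  obtain ⟨m, w, hw⟩ := exists_toTorus_eq_lb_pow_mul hε hnonneg
  refine ⟨x, hx, hnonneg, m, w, toTorus_injective hε ?_⟩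
  rw [map_mul, map_mul, hx, hw, ← mul_assoc, ← mul_assoc, (hcomm _).eq]

lemma exists_eq_mul_of_ideal (hl : 0 < l) (hs : IsPrimitiveRoot (sqUnit hε) l)
    {J : AddSubgroup (Lspec ε)} (hJ : ∀ u, ∀ j ∈ J, u * j ∈ J) (hJ' : ∀ u, ∀ j ∈ J, j * u ∈ J)
    {j₀ : Lspec ε} (hj₀ : j₀ ∈ J) (hj₀' : j₀ ≠ 0) {y z : Lspec ε}
    (hz : z ∈ Subring.center (Lspec ε)) (hz0 : z ≠ 0) (hy : ∀ j ∈ J, ∃ j' ∈ J, y * j = z * j')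
    (hy' : ∀ j ∈ J, ∃ j' ∈ J, j * y = z * j') : ∃ w, y = z * w := by
  have hz1 : toTorus hε z ≠ 0 := (map_ne_zero_iff _ (toTorus_injective hε)).2 hz0
  have hinj : Function.Injective (tau (ε := ε)) := Function.LeftInverse.injective tau_tau
  have tau_zero : tau (0 : Lspec ε) = 0 := by simp [tau]
  obtain ⟨x, hx, hnonneg, -⟩ := exists_toTorus_eq_mul hε hl hs hJ hj₀ hj₀' hz hz0 hy
  obtain ⟨-, -, -, m', w', h⟩ := exists_toTorus_eq_mul hε hl hs
    (J := J.map (AddMonoidHom.mk' tau tau_add)) (j₀ := tau j₀) (y := tau y) (z := tau z)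
    (by
      rintro u _ ⟨j, hj, rfl⟩
      exact ⟨j * tau u, hJ' _ _ hj, by simp [tau_mul, tau_tau]⟩)
    ⟨j₀, hj₀, rfl⟩ (by rw [← tau_zero]; exact hinj.ne hj₀') (tau_mem_center hz)
    (by rw [← tau_zero]; exact hinj.ne hz0)
    (by
      rintro _ ⟨j, hj, rfl⟩
      obtain ⟨j', hj', h⟩ := hy' j hj
      refine ⟨_, ⟨j', hj', rfl⟩, ?_⟩
      change tau y * tau j = tau z * tau j'
      rw [← tau_mul, h, ← Subring.mem_center_iff.1 hz, tau_mul])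
  have h2 : y * lc ε ^ m' = z * tau w' := by
    have := congrArg tau h
    rwa [tau_mul, tau_mul, tau_tau, tau_tau, tau_pow, tau_lb, Subring.mem_center_iff.1 hz] at this
  have hxc : x * toTorus hε (lc ε ^ m') = toTorus hε (tau w') := by
    apply mul_left_cancel₀ hz1
    rw [← mul_assoc, ← hx, ← map_mul, h2, map_mul]
  have hlc : toTorus hε (lc ε ^ m') ≠ 0 := by
    cases m' with
    | zero => simp
    | succ m' => exact toTorus_homGen_ne_zero hε (Int.negSucc m')
  suffices hmem : x ∈ (toTorus hε).range by
    obtain ⟨w, rfl⟩ := hmem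
    exact ⟨w, toTorus_injective hε (by rw [map_mul]; exact hx)⟩
  rw [← sum_comp x]
  refine sum_mem fun n _ => ?_
  rcases n with n | n
  · conv => enter [2, 2]; rw [← sum_mon x]
    rw [map_sum]
    refine sum_mem fun g hg => ?_
    rw [comp_mon]
    split_ifs with h
    · refine ⟨_, (toTorus_ofPoly_mul_lb_pow hε g.1.toNat n (QTorus.coeff g x)).trans ?_⟩
      have hn : ((g.1.toNat : ℤ), (n : ℤ)) = g :=
        Prod.ext (Int.toNat_of_nonneg (hnonneg g (mem_supp.1 hg))) h.symm
      rw [hn]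
    · exact zero_mem _
  · obtain ⟨p, hp⟩ := exists_comp_toTorus hε (tau w') (Int.negSucc n - m')
    have h3 := comp_mul_comp (Int.negSucc n) (-m') x (toTorus hε (lc ε ^ m'))
    rw [comp_toTorus_lc_pow, hxc, ← sub_eq_add_neg, hp] at h3
    have h4 : homGen ε (Int.negSucc n - m') = lc ε ^ (n + 1) * lc ε ^ m' := by
      have : Int.negSucc n - m' = Int.negSucc (n + m') := by omega
      rw [this, homGen, ← pow_add]
      congr 1
      omega
    rw [h4, ← mul_assoc, map_mul] at h3
    exact ⟨_, mul_right_cancel₀ hlc h3⟩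

end Lspec

namespace Lspec

open Polynomial QTorus

variable {ε : ℂ} (hε : ε ≠ 0) {l : ℕ}

lemma isPrimitiveRoot_sqUnit (hodd : Odd l) (h : IsPrimitiveRoot ε l) :
    IsPrimitiveRoot (sqUnit hε) l := by
  rw [← IsPrimitiveRoot.coe_units_iff]
  exact h.pow_of_coprime 2 (Nat.coprime_two_left.2 hodd)

lemma mem_center_of_toTorus_eq (hs : IsPrimitiveRoot (sqUnit hε) l) {y : Lspec ε} {g : ℤ × ℤ}
    (hy : toTorus hε y = mon _ ((l : ℤ) • g) 1) : y ∈ Subring.center (Lspec ε) := by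
  rw [Subring.mem_center_iff]
  intro x
  apply toTorus_injective hε
  rw [map_mul, map_mul, hy]
  induction toTorus hε x using induction_mon with
  | hadd f f' h h' => rw [add_mul, mul_add, h, h']
  | hmon a r =>
    rw [mon_mul_mon, mon_mul_mon, tw_lattice_left hs, tw_lattice_right hs, add_comm, mul_comm r]

lemma ld_pow_mem_center (hs : IsPrimitiveRoot (sqUnit hε) l) :
    ld ε ^ l ∈ Subring.center (Lspec ε) := by
  refine mem_center_of_toTorus_eq hε hs (g := (1, 0)) ?_
  rw [map_pow, toTorus_ld, mon_pow _ (by simp), natCast_zsmul]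

lemma lb_pow_mem_center (hs : IsPrimitiveRoot (sqUnit hε) l) :
    lb ε ^ l ∈ Subring.center (Lspec ε) := by
  refine mem_center_of_toTorus_eq hε hs (g := (0, 1)) ?_
  rw [map_pow, toTorus_lb, mon_pow _ (by simp), natCast_zsmul]

lemma lc_pow_mem_center (hs : IsPrimitiveRoot (sqUnit hε) l) :
    lc ε ^ l ∈ Subring.center (Lspec ε) := by
  have := tau_mem_center (lb_pow_mem_center hε hs)
  rwa [tau_pow, tau_lb] at this

lemma aeval_omegaL_mem_center (hε : ε ≠ 0) (r : ℂ[X]) :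
    aeval (omegaL ε) r ∈ Subring.center (Lspec ε) := by
  induction r using Polynomial.induction_on' with
  | add p q hp hq => rw [map_add]; exact add_mem hp hq
  | monomial n r =>
    rw [aeval_monomial]
    exact mul_mem (Subring.mem_center_iff.2 fun x => (Algebra.commutes r x).symm)
      (pow_mem (omegaL_mem_center hε) n)

lemma fg_top (hl : 0 < l) (hs : IsPrimitiveRoot (sqUnit hε) l) :
    (⊤ : Submodule (ZL ε) (Lspec ε)).FG := by
  let G : Fin l × Fin l × Bool → Lspec ε := fun i =>
    ld ε ^ (i.1 : ℕ) * (bif i.2.2 then lb ε else lc ε) ^ (i.2.1 : ℕ)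
  have hZ : ∀ z ∈ Subring.center (Lspec ε), ∀ x ∈ Submodule.span (ZL ε) (Set.range G),
      z * x ∈ Submodule.span (ZL ε) (Set.range G) := fun z hz x hx =>
    Submodule.smul_mem _ (⟨z, hz⟩ : ZL ε) hx
  have hpow : ∀ (x : Lspec ε) (n : ℕ), x ^ n = (x ^ l) ^ (n / l) * x ^ (n % l) := fun x n => by
    rw [← pow_mul, ← pow_add, Nat.div_add_mod]
  have key : ∀ (i j : ℕ) (t : Bool), ld ε ^ i * (bif t then lb ε else lc ε) ^ j ∈
      Submodule.span (ZL ε) (Set.range G) := by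
    intro i j t
    have ht : (bif t then lb ε else lc ε) ^ l ∈ Subring.center (Lspec ε) := by
      cases t
      · exact lc_pow_mem_center hε hs
      · exact lb_pow_mem_center hε hs
    rw [hpow _ i, hpow _ j, mul_assoc, ← mul_assoc (ld ε ^ (i % l)),
      Subring.mem_center_iff.1 (pow_mem ht _), mul_assoc]
    exact hZ _ (pow_mem (ld_pow_mem_center hε hs) _) _ (hZ _ (pow_mem ht _) _
      (Submodule.subset_span ⟨(⟨i % l, Nat.mod_lt _ hl⟩, ⟨j % l, Nat.mod_lt _ hl⟩, t), rfl⟩))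
  refine Submodule.fg_def.2 ⟨_, Set.finite_range G, eq_top_iff.2 fun x _ => ?_⟩
  obtain ⟨f, rfl⟩ := ofHomogeneous_surjective hε x
  induction f using Finsupp.induction_linear with
  | zero => rw [map_zero]; exact zero_mem _
  | add f g hf hg => rw [map_add]; exact add_mem (hf trivial) (hg trivial)
  | single n p =>
    rw [ofHomogeneous_single]
    induction p using Polynomial.induction_on' with
    | add p q hp hq => rw [map_add, add_mul]; exact add_mem (hp trivial) (hq trivial)
    | monomial k r =>
      rw [ofPoly_monomial, mul_assoc]
      refine hZ _ (aeval_omegaL_mem_center hε r) _ ?_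
      cases n with
      | ofNat n => exact key k n true
      | negSucc n => exact key k (n + 1) false

lemma isClassicalOrder_LBar (hl : 0 < l) (hs : IsPrimitiveRoot (sqUnit hε) l) :
    IsClassicalOrder ε (LBar ε) := by
  refine ⟨?_, ?_, ?_⟩
  · rintro _ ⟨z, rfl⟩
    refine ⟨(z : Lspec ε), ?_⟩
    exact (Algebra.TensorProduct.includeRight : Lspec ε →ₐ[ZL ε] QLL ε).commutes z
  · have h := (fg_top hε hl hs).map
      (Algebra.TensorProduct.includeRight : Lspec ε →ₐ[ZL ε] QLL ε).toLinearMap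
    rw [Submodule.map_top, ← Submodule.span_eq (LinearMap.range _)] at h
    exact h
  · rw [eq_top_iff]
    rintro x -
    induction x using TensorProduct.induction_on with
    | zero => exact zero_mem _
    | add x y hx hy => exact add_mem hx hy
    | tmul q y =>
      have : q ⊗ₜ[ZL ε] y = q • ((1 : QZL ε) ⊗ₜ[ZL ε] y) := by
        rw [TensorProduct.smul_tmul', smul_eq_mul, mul_one]
      rw [this]
      exact Submodule.smul_mem _ _ (Submodule.subset_span ⟨y, rfl⟩)

instance isLocalizedModule_mk (ε : ℂ) : IsLocalizedModule (nonZeroDivisors (ZL ε))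
    (TensorProduct.mk (ZL ε) (QZL ε) (Lspec ε) 1) :=
  (isLocalizedModule_iff_isBaseChange (nonZeroDivisors (ZL ε)) (QZL ε) _).2
    (TensorProduct.isBaseChange (ZL ε) (Lspec ε) (QZL ε))

lemma isDomain (hε : ε ≠ 0) : IsDomain (Lspec ε) :=
  (toTorus_injective hε).isDomain (toTorus hε : Lspec ε →+* QTorus (sqUnit hε))

lemma one_tmul_injective (hε : ε ≠ 0) :
    Function.Injective fun y : Lspec ε => (1 : QZL ε) ⊗ₜ[ZL ε] y := by
  intro x y hxy
  have := isDomain hε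
  obtain ⟨c, hc⟩ := (IsLocalizedModule.eq_iff_exists (nonZeroDivisors (ZL ε))
    (TensorProduct.mk (ZL ε) (QZL ε) (Lspec ε) 1)).1 hxy
  have hc0 : ((c : ZL ε) : Lspec ε) ≠ 0 := fun h => nonZeroDivisors.coe_ne_zero c (Subtype.ext h)
  exact mul_left_cancel₀ hc0 hc

lemma exists_smul_eq_one_tmul (x : QLL ε) :
    ∃ z ∈ nonZeroDivisors (ZL ε), ∃ y : Lspec ε, z • x = (1 : QZL ε) ⊗ₜ[ZL ε] y := by
  obtain ⟨⟨y, z⟩, h⟩ := IsLocalizedModule.surj (nonZeroDivisors (ZL ε))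
    (TensorProduct.mk (ZL ε) (QZL ε) (Lspec ε) 1) x
  exact ⟨z, z.2, y, h⟩

lemma exists_smul_mem_of_fg {M : Submodule (ZL ε) (QLL ε)} (hM : M.FG) :
    ∃ z ∈ nonZeroDivisors (ZL ε), ∀ x ∈ M, ∃ y : Lspec ε, z • x = (1 : QZL ε) ⊗ₜ[ZL ε] y := by
  induction M, hM using Submodule.fg_induction with
  | singleton x =>
    obtain ⟨z, hz, y, h⟩ := exists_smul_eq_one_tmul x
    refine ⟨z, hz, fun x' hx' => ?_⟩
    obtain ⟨r, rfl⟩ := Submodule.mem_span_singleton.1 hx'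
    exact ⟨r • y, by rw [smul_comm, h, TensorProduct.tmul_smul]⟩
  | sup M N hM hN h1 h2 =>
    obtain ⟨z, hz, h1⟩ := h1
    obtain ⟨z', hz', h2⟩ := h2
    refine ⟨z * z', mul_mem hz hz', fun x hx => ?_⟩
    obtain ⟨u, hu, v, hv, rfl⟩ := Submodule.mem_sup.1 hx
    obtain ⟨y, hy⟩ := h1 u hu
    obtain ⟨y', hy'⟩ := h2 v hv
    refine ⟨z' • y + z • y', ?_⟩
    rw [smul_add, mul_comm, mul_smul, hy, mul_comm, mul_smul, hy', TensorProduct.tmul_add,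
      TensorProduct.tmul_smul, TensorProduct.tmul_smul]

lemma le_LBar (hε : ε ≠ 0) (hl : 0 < l) (hs : IsPrimitiveRoot (sqUnit hε) l) {B : Subring (QLL ε)}
    (hB : IsClassicalOrder ε B) (hLB : LBar ε ≤ B) : B ≤ LBar ε := by
  have := isDomain hε
  have hinj := one_tmul_injective hε
  obtain ⟨z₀, hz₀, hfg⟩ := exists_smul_mem_of_fg hB.2.1
  have hmem : ∀ u : Lspec ε, (1 : QZL ε) ⊗ₜ[ZL ε] u ∈ B := fun u => hLB ⟨u, rfl⟩
  have hmul : ∀ u v : Lspec ε, (1 : QZL ε) ⊗ₜ[ZL ε] (u * v) =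
      ((1 : QZL ε) ⊗ₜ[ZL ε] u) * ((1 : QZL ε) ⊗ₜ[ZL ε] v) := fun u v => by
    rw [Algebra.TensorProduct.tmul_mul_tmul, one_mul]
  have hne : ∀ z ∈ nonZeroDivisors (ZL ε), (z : Lspec ε) ≠ 0 := fun z hz h =>
    nonZeroDivisors.ne_zero hz (Subtype.ext h)
  let J : AddSubgroup (Lspec ε) :=
    { carrier := {y | ∃ β ∈ B, (1 : QZL ε) ⊗ₜ[ZL ε] y = z₀ • β}
      add_mem' := by
        rintro x y ⟨β, hβ, h⟩ ⟨β', hβ', h'⟩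
        exact ⟨β + β', add_mem hβ hβ', by rw [TensorProduct.tmul_add, h, h', smul_add]⟩
      zero_mem' := ⟨0, zero_mem _, by simp⟩
      neg_mem' := by
        rintro x ⟨β, hβ, h⟩
        exact ⟨-β, neg_mem hβ, by rw [TensorProduct.tmul_neg, h, smul_neg]⟩ }
  have hJ : ∀ β ∈ B, ∃ j ∈ J, (1 : QZL ε) ⊗ₜ[ZL ε] j = z₀ • β := fun β hβ => by
    obtain ⟨y, hy⟩ := hfg β (Submodule.subset_span hβ)
    exact ⟨y, ⟨β, hβ, hy.symm⟩, hy.symm⟩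
  intro x hx
  obtain ⟨z, hz, y, hy⟩ := exists_smul_eq_one_tmul x
  have hsmul : ∀ (r : ZL ε) (u : Lspec ε), (r : Lspec ε) * u = r • u := fun _ _ => rfl
  obtain ⟨w, hw⟩ := exists_eq_mul_of_ideal hε hl hs (J := J) (y := y) (z := z)
    (j₀ := (z₀ : Lspec ε))
    (by
      rintro u j ⟨β, hβ, h⟩
      exact ⟨_, mul_mem (hmem u) hβ, by rw [hmul, h, mul_smul_comm]⟩)
    (by
      rintro u j ⟨β, hβ, h⟩
      exact ⟨_, mul_mem hβ (hmem u), by rw [hmul, h, smul_mul_assoc]⟩)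
    ⟨1, one_mem _, by
      rw [← mul_one (z₀ : Lspec ε), hsmul, TensorProduct.tmul_smul]; rfl⟩
    (hne z₀ hz₀) z.2 (hne z hz)
    (by
      rintro j ⟨β, hβ, h⟩
      obtain ⟨j', hj', h'⟩ := hJ (x * β) (mul_mem hx hβ)
      refine ⟨j', hj', hinj ?_⟩
      simp only [hsmul, hmul, TensorProduct.tmul_smul]
      rw [← hy, h, h', smul_mul_assoc, mul_smul_comm])
    (by
      rintro j ⟨β, hβ, h⟩
      obtain ⟨j', hj', h'⟩ := hJ (β * x) (mul_mem hβ hx)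
      refine ⟨j', hj', hinj ?_⟩
      simp only [hsmul, hmul, TensorProduct.tmul_smul]
      rw [← hy, h, h', mul_smul_comm, smul_mul_assoc])
  refine ⟨w, ?_⟩
  rw [hw, hsmul, TensorProduct.tmul_smul] at hy
  exact (IsLocalizedModule.smul_injective (TensorProduct.mk (ZL ε) (QZL ε) (Lspec ε) 1)
    (⟨z, hz⟩ : nonZeroDivisors (ZL ε)) hy).symm

end Lspec

/-- Let `l ≥ 3` be odd and `ε` a primitive `l`-th root of unity.  Then 𝓛(ε) is a
maximal order of `Q(𝓛(ε)) := Q(Z) ⊗_Z 𝓛(ε)`, where `Z` is the center of 𝓛(ε): the canonical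
image of 𝓛(ε) in `Q(𝓛(ε))` is a classical order, and every classical order of `Q(𝓛(ε))`
containing this image is equal to it. -/
theorem stmt_10 (l : ℕ) (hodd : Odd l) (hl : 3 ≤ l) (ε : ℂ) (hε : IsPrimitiveRoot ε l) :
    IsClassicalOrder ε (LBar ε) ∧
    ∀ B : Subring (QLL ε), IsClassicalOrder ε B → LBar ε ≤ B → B = LBar ε := by
  have hl₀ : 0 < l := by omega
  have hε₀ : ε ≠ 0 := hε.ne_zero hl₀.ne'
  have hs := Lspec.isPrimitiveRoot_sqUnit hε₀ hodd hε
  exact ⟨Lspec.isClassicalOrder_LBar hε₀ hl₀ hs, fun B hB hLB =>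
    le_antisymm (Lspec.le_LBar hε₀ hl₀ hs hB hLB) hLB⟩

end
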